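/- arXiv:2202.11912 — 16 statements merged into one kernel-verified Lean document; each statement's English description precedes it below -/
import Mathlib

section
/- Let x,x' ∈ ℝⁿ, let γ : [0,1] → [x,x'] be a monotone path from x' to x (each component γᵢ is a monotone function of t), and let F be continuously differentiable on the hyperrectangle [x,x'] with sign(xᵢ − x'ᵢ) · (∂F/∂xᵢ)(y) ≥ 0 for every y ∈ [x,x'] and every i. Then A^γᵢ(x,x',F) ≥ 0 for every i; that is, monotone path methods assign nonnegative attributions to every coordinate in this situation. -/
open MeasureTheory Set

/-- The partial derivative of `F` in coordinate `i` at the point `y`. -/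
noncomputable def pderiv' {n : ℕ} (F : (Fin n → ℝ) → ℝ) (i : Fin n) (y : Fin n → ℝ) : ℝ :=
  fderiv ℝ F y (Pi.single i 1)

/-- The closed hyperrectangle `[a,b]` with opposite corners `a` and `b`. -/
def Box {n : ℕ} (a b : Fin n → ℝ) : Set (Fin n → ℝ) :=
  {y | ∀ i, min (a i) (b i) ≤ y i ∧ y i ≤ max (a i) (b i)}

/-- `γ` is a continuous, piecewise continuously differentiable path on `[0,1]`
from `x'` to `x`. -/
def IsPWC1Path {n : ℕ} (γ : ℝ → (Fin n → ℝ)) (x' x : Fin n → ℝ) : Prop :=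
  ContinuousOn γ (Set.Icc 0 1) ∧ γ 0 = x' ∧ γ 1 = x ∧
    ∃ S : Finset ℝ,
      (∀ t ∈ Set.Ioo (0:ℝ) 1 \ (S : Set ℝ), DifferentiableAt ℝ γ t) ∧
      ContinuousOn (deriv γ) (Set.Ioo (0:ℝ) 1 \ (S : Set ℝ)) ∧
      IntervalIntegrable (deriv γ) MeasureTheory.volume 0 1

/-- A path is monotone if each component is a monotone function of `t` on `[0,1]`. -/
def IsMonotonePath {n : ℕ} (γ : ℝ → (Fin n → ℝ)) : Prop :=
  ∀ i, MonotoneOn (fun t => γ t i) (Set.Icc 0 1) ∨ AntitoneOn (fun t => γ t i) (Set.Icc 0 1)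

/-- The path method attribution `A^γᵢ(x,x',F) = ∫₀¹ ∂F/∂xᵢ(γ(t)) ⬝ γᵢ'(t) dt`. -/
noncomputable def pathAttr {n : ℕ} (γ : ℝ → (Fin n → ℝ)) (F : (Fin n → ℝ) → ℝ)
    (i : Fin n) : ℝ :=
  ∫ t in (0:ℝ)..1, pderiv' F i (γ t) * deriv γ t i

/-- `F` is non-decreasing from `x'` to `x`: `F ∘ γ` is non-decreasing on `[0,1]` for every
monotone path `γ` from `x'` to `x`. -/
def NonDecreasingFromTo {n : ℕ} (F : (Fin n → ℝ) → ℝ) (x' x : Fin n → ℝ) : Prop :=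
  ∀ γ : ℝ → (Fin n → ℝ), IsPWC1Path γ x' x → IsMonotonePath γ →
    MonotoneOn (fun t => F (γ t)) (Set.Icc 0 1)

/-- Integrated gradients: `IGᵢ(x,x',F) = (xᵢ - x'ᵢ) ∫₀¹ ∂F/∂xᵢ(x' + t(x - x')) dt`. -/
noncomputable def IG {n : ℕ} (F : (Fin n → ℝ) → ℝ) (i : Fin n) (x x' : Fin n → ℝ) : ℝ :=
  (x i - x' i) * ∫ t in (0:ℝ)..1, pderiv' F i (x' + t • (x - x'))

/-- monotone path methods give nonnegative attributions when the signed
partial derivatives of `F` are nonnegative on `[x,x']`. -/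
theorem monotone_path_method_nonneg {n : ℕ} (x x' : Fin n → ℝ)
    (γ : ℝ → (Fin n → ℝ)) (hγ : IsPWC1Path γ x' x) (hmono : IsMonotonePath γ)
    (hγbox : ∀ t ∈ Set.Icc (0:ℝ) 1, γ t ∈ Box x x')
    (F : (Fin n → ℝ) → ℝ) (hF : ContDiff ℝ 1 F)
    (hsign : ∀ y ∈ Box x x', ∀ i, 0 ≤ Real.sign (x i - x' i) * pderiv' F i y) :
    ∀ i, 0 ≤ pathAttr γ F i := by
  intro i
  obtain ⟨_, h0, h1, _⟩ := hγ
  have m0 : (0:ℝ) ∈ Set.Icc (0:ℝ) 1 := by simp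
  have m1 : (1:ℝ) ∈ Set.Icc (0:ℝ) 1 := by simp
  unfold pathAttr
  rw [intervalIntegral.integral_of_le zero_le_one, MeasureTheory.integral_Ioc_eq_integral_Ioo]
  refine MeasureTheory.setIntegral_nonneg measurableSet_Ioo ?_
  intro t ht
  have hnhds : Set.Icc (0:ℝ) 1 ∈ nhds t := Icc_mem_nhds ht.1 ht.2
  have htI : t ∈ Set.Icc (0:ℝ) 1 := ⟨ht.1.le, ht.2.le⟩
  by_cases hd : DifferentiableAt ℝ γ t
  swap
  · simp [deriv_zero_of_not_differentiableAt hd]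
  have hc : deriv γ t i = deriv (fun s => γ s i) t :=
    ((hasDerivAt_pi.1 hd.hasDerivAt i).deriv).symm
  have hw : deriv γ t i = derivWithin (fun s => γ s i) (Set.Icc 0 1) t := by
    rw [hc, derivWithin_of_mem_nhds hnhds]
  have hs := hsign (γ t) (hγbox t htI) i
  rcases lt_trichotomy (x i) (x' i) with hlt | heq | hgt
  · rw [Real.sign_of_neg (by linarith)] at hs
    have ha : AntitoneOn (fun t => γ t i) (Set.Icc 0 1) := by
      rcases hmono i with h | h
      · have := h m0 m1 zero_le_one
        simp only [h0, h1] at this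
        linarith
      · exact h
    have hn : deriv γ t i ≤ 0 := by
      rw [hw]; exact ha.derivWithin_nonpos
    exact mul_nonneg_of_nonpos_of_nonpos (by linarith) hn
  · have he : (fun s => γ s i) =ᶠ[nhds t] fun _ => x i := by
      filter_upwards [hnhds] with s hs'
      have := hγbox s hs' i
      rw [← heq, min_self, max_self] at this
      exact le_antisymm this.2 this.1
    have hz : deriv γ t i = 0 := by
      rw [hc, he.deriv_eq]; simp
    simp [hz]
  · rw [Real.sign_of_pos (by linarith)] at hs
    have ha : MonotoneOn (fun t => γ t i) (Set.Icc 0 1) := by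
      rcases hmono i with h | h
      · exact h
      · have := h m0 m1 zero_le_one
        simp only [h0, h1] at this
        linarith
    have hn : 0 ≤ deriv γ t i := by
      rw [hw]; exact ha.derivWithin_nonneg
    exact mul_nonneg (by linarith) hn
end

section
/- Let F(y₁,y₂) = y₁y₂ on [0,1]², x' = (0,0), x = (1,0). Then: (i) for every monotone path γ from x' to x contained in [0,1]², the path method attribution A^γ(x,x',F) is componentwise nonnegative; (ii) for the constant-speed piecewise-linear (non-monotone) path γ' that travels (0,0) → (0,1) → (1,1) → (1,0), the path method attribution is A^{γ'}(x,x',F) = (1, −1). In particular, A^{γ'}(x,x',F) has a negative component and hence differs from every monotone path method attribution (and from every average of monotone path method attributions) at this input. -/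
open MeasureTheory Set

/-- The constant-speed piecewise-linear non-monotone path
`(0,0) → (0,1) → (1,1) → (1,0)`. -/
noncomputable def gammaNonMono : ℝ → (Fin 2 → ℝ) := fun t =>
  if t ≤ 1/3 then ![0, 3 * t]
  else if t ≤ 2/3 then ![3 * t - 1, 1]
  else ![1, 3 - 3 * t]

lemma pderiv_prod_zero (y : Fin 2 → ℝ) :
    pderiv' (fun y : Fin 2 → ℝ => y 0 * y 1) 0 y = y 1 := by
  have h0 : HasFDerivAt (fun y : Fin 2 → ℝ => y 0) (ContinuousLinearMap.proj 0) y :=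
    (ContinuousLinearMap.proj (R := ℝ) (φ := fun _ : Fin 2 => ℝ) 0).hasFDerivAt
  have h1 : HasFDerivAt (fun y : Fin 2 → ℝ => y 1) (ContinuousLinearMap.proj 1) y :=
    (ContinuousLinearMap.proj (R := ℝ) (φ := fun _ : Fin 2 => ℝ) 1).hasFDerivAt
  have h := (h0.mul h1).fderiv
  unfold pderiv'
  erw [h]
  simp

lemma pderiv_prod_one (y : Fin 2 → ℝ) :
    pderiv' (fun y : Fin 2 → ℝ => y 0 * y 1) 1 y = y 0 := by
  have h0 : HasFDerivAt (fun y : Fin 2 → ℝ => y 0) (ContinuousLinearMap.proj 0) y :=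
    (ContinuousLinearMap.proj (R := ℝ) (φ := fun _ : Fin 2 => ℝ) 0).hasFDerivAt
  have h1 : HasFDerivAt (fun y : Fin 2 → ℝ => y 1) (ContinuousLinearMap.proj 1) y :=
    (ContinuousLinearMap.proj (R := ℝ) (φ := fun _ : Fin 2 => ℝ) 1).hasFDerivAt
  have h := (h0.mul h1).fderiv
  unfold pderiv'
  erw [h]
  simp

lemma integral_of_const_Ioo {f : ℝ → ℝ} {a b c : ℝ} (hab : a ≤ b)
    (h : ∀ t ∈ Set.Ioo a b, f t = c) :
    IntervalIntegrable f volume a b ∧ ∫ t in a..b, f t = (b - a) * c := by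
  have hae : (fun _ => c) =ᵐ[volume.restrict (Set.Ioc a b)] f := by
    rw [← Measure.restrict_congr_set (Ioo_ae_eq_Ioc (μ := volume) (a := a) (b := b))]
    filter_upwards [ae_restrict_mem measurableSet_Ioo] with t ht
    exact (h t ht).symm
  constructor
  · have hc : IntervalIntegrable (fun _ : ℝ => c) volume a b := intervalIntegrable_const
    rw [intervalIntegrable_iff_integrableOn_Ioc_of_le hab] at hc ⊢
    exact hc.congr hae
  · rw [intervalIntegral.integral_of_le hab, ← integral_congr_ae hae,
      ← intervalIntegral.integral_of_le hab]
    simp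

lemma integral_three {f : ℝ → ℝ} {c₁ c₂ c₃ : ℝ}
    (h₁ : ∀ t ∈ Set.Ioo (0:ℝ) (1/3), f t = c₁)
    (h₂ : ∀ t ∈ Set.Ioo (1/3:ℝ) (2/3), f t = c₂)
    (h₃ : ∀ t ∈ Set.Ioo (2/3:ℝ) 1, f t = c₃) :
    ∫ t in (0:ℝ)..1, f t = (c₁ + c₂ + c₃) / 3 := by
  obtain ⟨i₁, e₁⟩ := integral_of_const_Ioo (by norm_num) h₁
  obtain ⟨i₂, e₂⟩ := integral_of_const_Ioo (by norm_num) h₂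
  obtain ⟨i₃, e₃⟩ := integral_of_const_Ioo (by norm_num) h₃
  rw [← intervalIntegral.integral_add_adjacent_intervals (i₁.trans i₂) i₃,
    ← intervalIntegral.integral_add_adjacent_intervals i₁ i₂, e₁, e₂, e₃]
  ring

lemma hasDerivAt_vec2 {f g : ℝ → ℝ} {f' g' t : ℝ} (hf : HasDerivAt f f' t)
    (hg : HasDerivAt g g' t) : HasDerivAt (fun s => ![f s, g s]) ![f', g'] t := by
  rw [hasDerivAt_pi]
  intro i
  fin_cases i
  · simpa using hf
  · simpa using hg

lemma gamma_seg1 {t : ℝ} (ht : t ∈ Set.Ioo (0:ℝ) (1/3)) :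
    gammaNonMono t = ![0, 3 * t] ∧ deriv gammaNonMono t = ![0, 3] := by
  have key : ∀ s ∈ Set.Ioo (0:ℝ) (1/3), gammaNonMono s = ![0, 3 * s] := by
    intro s hs
    simp only [gammaNonMono, if_pos hs.2.le]
  refine ⟨key t ht, ?_⟩
  have he : gammaNonMono =ᶠ[nhds t] fun s => ![0, 3 * s] := by
    filter_upwards [isOpen_Ioo.mem_nhds ht] with s hs using key s hs
  rw [he.deriv_eq]
  exact (hasDerivAt_vec2 (hasDerivAt_const t 0)
    (by simpa using (hasDerivAt_id t).const_mul 3)).deriv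

lemma gamma_seg2 {t : ℝ} (ht : t ∈ Set.Ioo (1/3:ℝ) (2/3)) :
    gammaNonMono t = ![3 * t - 1, 1] ∧ deriv gammaNonMono t = ![3, 0] := by
  have key : ∀ s ∈ Set.Ioo (1/3:ℝ) (2/3), gammaNonMono s = ![3 * s - 1, 1] := by
    intro s hs
    simp only [gammaNonMono, if_neg (not_le.2 hs.1), if_pos hs.2.le]
  refine ⟨key t ht, ?_⟩
  have he : gammaNonMono =ᶠ[nhds t] fun s => ![3 * s - 1, 1] := by
    filter_upwards [isOpen_Ioo.mem_nhds ht] with s hs using key s hs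
  rw [he.deriv_eq]
  exact (hasDerivAt_vec2 (by simpa using ((hasDerivAt_id t).const_mul 3).sub_const 1)
    (hasDerivAt_const t 1)).deriv

lemma gamma_seg3 {t : ℝ} (ht : t ∈ Set.Ioo (2/3:ℝ) 1) :
    gammaNonMono t = ![1, 3 - 3 * t] ∧ deriv gammaNonMono t = ![0, -3] := by
  have key : ∀ s ∈ Set.Ioo (2/3:ℝ) 1, gammaNonMono s = ![1, 3 - 3 * s] := by
    intro s hs
    have h1 : ¬ s ≤ 1/3 := by have := hs.1; intro h; linarith
    simp only [gammaNonMono, if_neg h1, if_neg (not_le.2 hs.1)]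
  refine ⟨key t ht, ?_⟩
  have he : gammaNonMono =ᶠ[nhds t] fun s => ![1, 3 - 3 * s] := by
    filter_upwards [isOpen_Ioo.mem_nhds ht] with s hs using key s hs
  rw [he.deriv_eq]
  exact (hasDerivAt_vec2 (hasDerivAt_const t 1)
    (by simpa using ((hasDerivAt_id t).const_mul 3).const_sub 3)).deriv

/-- for `F(y₁,y₂) = y₁y₂`, `x' = (0,0)`, `x = (1,0)`:
(i) every monotone path method gives componentwise nonnegative attributions;
(ii) the non-monotone path `(0,0) → (0,1) → (1,1) → (1,0)` gives attribution `(1,-1)`. -/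
theorem nonmonotone_path_counterexample :
    (∀ γ : ℝ → (Fin 2 → ℝ), IsPWC1Path γ ![0, 0] ![1, 0] → IsMonotonePath γ →
      (∀ t ∈ Set.Icc (0:ℝ) 1, ∀ i, γ t i ∈ Set.Icc (0:ℝ) 1) →
      ∀ i, 0 ≤ pathAttr γ (fun y => y 0 * y 1) i) ∧
    pathAttr gammaNonMono (fun y => y 0 * y 1) 0 = 1 ∧
    pathAttr gammaNonMono (fun y => y 0 * y 1) 1 = -1 := by
  refine ⟨?_, ?_, ?_⟩
  · intro γ hγ hm _ i
    obtain ⟨-, h0, h1, -⟩ := hγ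
    have m0 : (0:ℝ) ∈ Set.Icc (0:ℝ) 1 := by simp
    have m1 : (1:ℝ) ∈ Set.Icc (0:ℝ) 1 := by simp
    have e0 : γ 0 1 = 0 := by rw [h0]; simp
    have e1 : γ 1 1 = 0 := by rw [h1]; simp
    have hz : ∀ t ∈ Set.Icc (0:ℝ) 1, γ t 1 = 0 := by
      intro t ht
      rcases hm 1 with h | h
      · have a := h m0 ht ht.1
        have b := h ht m1 ht.2
        simp only at a b
        linarith
      · have a := h m0 ht ht.1
        have b := h ht m1 ht.2
        simp only at a b
        linarith
    have hd : ∀ t ∈ Set.Ioo (0:ℝ) 1, deriv γ t 1 = 0 := by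
      intro t ht
      by_cases hdt : DifferentiableAt ℝ γ t
      · have h2 := (hasDerivAt_pi.1 hdt.hasDerivAt) 1
        have he : (fun s => γ s 1) =ᶠ[nhds t] fun _ => (0:ℝ) := by
          filter_upwards [isOpen_Ioo.mem_nhds ht] with s hs using hz s ⟨hs.1.le, hs.2.le⟩
        exact (h2.congr_of_eventuallyEq he.symm).unique (hasDerivAt_const t 0)
      · rw [deriv_zero_of_not_differentiableAt hdt]; rfl
    have hi : pathAttr γ (fun y => y 0 * y 1) i = (1 - 0) * 0 := by
      unfold pathAttr
      refine (integral_of_const_Ioo zero_le_one ?_).2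
      intro t ht
      fin_cases i
      · simp [pderiv_prod_zero, hz t ⟨ht.1.le, ht.2.le⟩]
      · simp [hd t ht]
    rw [hi]; simp
  · unfold pathAttr
    rw [integral_three (c₁ := 0) (c₂ := 3) (c₃ := 0)]
    · norm_num
    · intro t ht
      rw [pderiv_prod_zero, (gamma_seg1 ht).1, (gamma_seg1 ht).2]; simp
    · intro t ht
      rw [pderiv_prod_zero, (gamma_seg2 ht).1, (gamma_seg2 ht).2]; simp
    · intro t ht
      rw [pderiv_prod_zero, (gamma_seg3 ht).1, (gamma_seg3 ht).2]; simp
  · unfold pathAttr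
    rw [integral_three (c₁ := 0) (c₂ := 0) (c₃ := -3)]
    · norm_num
    · intro t ht
      rw [pderiv_prod_one, (gamma_seg1 ht).1, (gamma_seg1 ht).2]; simp
    · intro t ht
      rw [pderiv_prod_one, (gamma_seg2 ht).1, (gamma_seg2 ht).2]; simp
    · intro t ht
      rw [pderiv_prod_one, (gamma_seg3 ht).1, (gamma_seg3 ht).2]; simp
end

section
/- Let A be a baseline attribution method on the class of continuously differentiable functions F : [a,b] → ℝ that satisfies linearity and sensitivity(b). Then for every index i, every x,x' ∈ [a,b], and every pair of continuously differentiable F, G : [a,b] → ℝ with ∂F/∂xᵢ = ∂G/∂xᵢ everywhere on [a,b], one has Aᵢ(x,x',F) = Aᵢ(x,x',G); that is, Aᵢ(x,x',F) is a function solely of x, x', and ∂F/∂xᵢ. -/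
open MeasureTheory Set

/-- a BAM satisfying linearity and sensitivity(b) depends, in its `i`-th
component, only on `x`, `x'`, and `∂F/∂xᵢ`. -/
theorem attr_component_depends_only_on_partial {n : ℕ} (a b : Fin n → ℝ)
    (A : (Fin n → ℝ) → (Fin n → ℝ) → ((Fin n → ℝ) → ℝ) → (Fin n → ℝ))
    (hlin : ∀ x x', x ∈ Box a b → x' ∈ Box a b →
      ∀ F G : (Fin n → ℝ) → ℝ, ContDiff ℝ 1 F → ContDiff ℝ 1 G → ∀ α β : ℝ,
        A x x' (fun y => α * F y + β * G y) = fun i => α * A x x' F i + β * A x x' G i)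
    (hdummy : ∀ x x', x ∈ Box a b → x' ∈ Box a b →
      ∀ F : (Fin n → ℝ) → ℝ, ContDiff ℝ 1 F → ∀ i,
        (∀ y ∈ Box a b, pderiv' F i y = 0) → A x x' F i = 0)
    (i : Fin n) (x x' : Fin n → ℝ) (hx : x ∈ Box a b) (hx' : x' ∈ Box a b)
    (F G : (Fin n → ℝ) → ℝ) (hF : ContDiff ℝ 1 F) (hG : ContDiff ℝ 1 G)
    (hFG : ∀ y ∈ Box a b, pderiv' F i y = pderiv' G i y) :
    A x x' F i = A x x' G i := by
  have hd := hdummy x x' hx hx' (fun y => 1 * F y + (-1) * G y)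
    ((contDiff_const.mul hF).add (contDiff_const.mul hG)) i (by
      intro y hy
      have hf := (hF.differentiable one_ne_zero) y
      have hg := (hG.differentiable one_ne_zero) y
      have h := (hf.hasFDerivAt.const_mul 1).add (hg.hasFDerivAt.const_mul (-1))
      have h2 : pderiv' (fun y => 1 * F y + (-1) * G y) i y
          = 1 * pderiv' F i y + (-1) * pderiv' G i y := by
        unfold pderiv'
        have h3 : fderiv ℝ (fun y => 1 * F y + (-1) * G y) y = _ := h.fderiv
        rw [h3]
        simp
      rw [h2, hFG y hy]
      ring)
  rw [hlin x x' hx hx' F G hF hG 1 (-1)] at hd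
  simp only at hd
  linarith
end

section
/- Let U ⊆ ℝⁿ be open and let f, g : U → ℝ be real-analytic on U. Then there exists an open set D ⊆ U such that U \ D has Lebesgue measure zero and the function y ↦ max(f(y), g(y)) is real-analytic on D. -/
open MeasureTheory Set

/-- If `h` is analytic on `ball p (2 r)` and nonzero at the center, its zero set in `ball p r`
is Lebesgue null. -/
lemma aux_null_zeros {n : ℕ} (h : (Fin n → ℝ) → ℝ) (p : Fin n → ℝ) (r : ℝ) (hr : 0 < r)
    (ha : AnalyticOnNhd ℝ h (Metric.ball p (2 * r))) (hp : h p ≠ 0) :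
    volume (Metric.ball p r ∩ {y | h y = 0}) = 0 := by
  set Z : Set (Fin n → ℝ) := {y | y ∈ Metric.ball p (2 * r) ∧ h y = 0} with hZ
  have hZm : MeasurableSet Z := by
    have ho : IsOpen (Metric.ball p (2 * r) ∩ h ⁻¹' {0}ᶜ) :=
      ha.continuousOn.isOpen_inter_preimage Metric.isOpen_ball isOpen_compl_singleton
    have : Z = Metric.ball p (2 * r) \ (Metric.ball p (2 * r) ∩ h ⁻¹' {0}ᶜ) := by
      ext y
      simp only [hZ, mem_ofPred_eq, mem_sdiff, mem_inter_iff, mem_preimage, mem_compl_iff,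
        mem_singleton_iff]
      tauto
    rw [this]
    exact Metric.isOpen_ball.measurableSet.diff ho.measurableSet
  have hmem : ∀ x ∈ Metric.ball p r, ∀ t ∈ Ioo (-2 : ℝ) 2,
      p + t • (x - p) ∈ Metric.ball p (2 * r) := by
    intro x hx t ht
    rw [mem_ball_iff_norm] at hx ⊢
    have h1 : |t| ≤ 2 := abs_le.2 ⟨ht.1.le, ht.2.le⟩
    rw [add_sub_cancel_left, norm_smul, Real.norm_eq_abs]
    nlinarith [norm_nonneg (x - p), abs_nonneg t]
  have hmeas : MeasurableSet {q : (Fin n → ℝ) × ℝ |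
      ¬ (q.1 ∈ Metric.ball p r ∧ q.2 ∈ Ioo (1 : ℝ) 2 ∧ p + q.2 • (q.1 - p) ∈ Z)} := by
    have hc : Measurable (fun q : (Fin n → ℝ) × ℝ => p + q.2 • (q.1 - p)) := by
      have : Continuous (fun q : (Fin n → ℝ) × ℝ => p + q.2 • (q.1 - p)) := by fun_prop
      exact this.measurable
    exact ((measurable_fst Metric.isOpen_ball.measurableSet).inter
      ((measurable_snd measurableSet_Ioo).inter (hc hZm))).compl
  have key : ∀ᵐ x : (Fin n → ℝ), ∀ᵐ t : ℝ,
      ¬ (x ∈ Metric.ball p r ∧ t ∈ Ioo (1 : ℝ) 2 ∧ p + t • (x - p) ∈ Z) := by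
    refine Filter.Eventually.of_forall fun x => ?_
    by_cases hx : x ∈ Metric.ball p r
    swap
    · exact Filter.Eventually.of_forall fun t ht => hx ht.1
    have hl : AnalyticOnNhd ℝ (fun t : ℝ => h (p + t • (x - p))) (Ioo (-2 : ℝ) 2) := by
      intro t ht
      have h2 : AnalyticAt ℝ (fun t : ℝ => p + t • (x - p)) t := by fun_prop
      exact AnalyticAt.comp' (f := fun t : ℝ => p + t • (x - p)) (ha _ (hmem x hx t ht)) h2
    rcases hl.eqOn_zero_or_eventually_ne_zero_of_preconnected isPreconnected_Ioo with h0 | h0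
    · exact absurd (by simpa using h0 (show (0 : ℝ) ∈ Ioo (-2 : ℝ) 2 by norm_num)) hp
    · have h1 := (ae_restrict_le_codiscreteWithin (μ := (volume : Measure ℝ))
        measurableSet_Ioo) h0
      have h3 := (ae_restrict_iff' measurableSet_Ioo).1 h1
      filter_upwards [h3] with t ht hh
      exact ht ⟨by linarith [hh.2.1.1], hh.2.1.2⟩ hh.2.2.2
  rw [Measure.ae_ae_comm hmeas] at key
  obtain ⟨t, ht, hk⟩ : ∃ t ∈ Ioo (1 : ℝ) 2, ∀ᵐ x : (Fin n → ℝ),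
      ¬ (x ∈ Metric.ball p r ∧ t ∈ Ioo (1 : ℝ) 2 ∧ p + t • (x - p) ∈ Z) := by
    by_contra hcon
    push Not at hcon
    have : volume (Ioo (1 : ℝ) 2) = 0 := by
      refine measure_mono_null ?_ (ae_iff.1 key)
      intro t ht hh
      exact hcon t ht (by simpa using hh)
    norm_num [Real.volume_Ioo] at this
  have hnull := ae_iff.1 hk
  simp only [not_not] at hnull
  have him := Measure.addHaar_image_homothety (volume : Measure (Fin n → ℝ)) p t
    {x | x ∈ Metric.ball p r ∧ t ∈ Ioo (1 : ℝ) 2 ∧ p + t • (x - p) ∈ Z}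
  rw [hnull, mul_zero] at him
  refine measure_mono_null ?_ him
  rintro y ⟨hy, hy0⟩
  have ht0 : t ≠ 0 := by linarith [ht.1]
  have ht1 : 1 < t := ht.1
  have hyy : p + t • ((p + t⁻¹ • (y - p)) - p) = y := by
    rw [add_sub_cancel_left, smul_smul, mul_inv_cancel₀ ht0, one_smul]; abel
  refine ⟨p + t⁻¹ • (y - p), ⟨?_, ht, ?_⟩, ?_⟩
  · rw [mem_ball_iff_norm] at hy ⊢
    rw [add_sub_cancel_left, norm_smul, Real.norm_eq_abs, abs_of_pos (by positivity)]
    have : t⁻¹ ≤ 1 := inv_le_one_of_one_le₀ ht1.le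
    nlinarith [norm_nonneg (y - p)]
  · rw [hyy]
    exact ⟨Metric.ball_subset_ball (by linarith) hy, hy0⟩
  · rw [AffineMap.homothety_apply, vsub_eq_sub, vadd_eq_add, add_comm]
    exact hyy

/-- the max of two real-analytic functions on an open set `U ⊆ ℝⁿ` is
real-analytic on an open subset `D ⊆ U` whose complement in `U` has Lebesgue measure zero. -/
theorem max_of_analytic_analyticOn_ae {n : ℕ} (U : Set (Fin n → ℝ)) (hU : IsOpen U)
    (f g : (Fin n → ℝ) → ℝ) (hf : AnalyticOnNhd ℝ f U) (hg : AnalyticOnNhd ℝ g U) :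
    ∃ D : Set (Fin n → ℝ), D ⊆ U ∧ IsOpen D ∧ volume (U \ D) = 0 ∧
      AnalyticOnNhd ℝ (fun y => max (f y) (g y)) D := by
  have hh : AnalyticOnNhd ℝ (fun y => f y - g y) U := hf.sub hg
  have ho : IsOpen (U ∩ (fun y => f y - g y) ⁻¹' {0}ᶜ) :=
    hh.continuousOn.isOpen_inter_preimage hU isOpen_compl_singleton
  refine ⟨(U ∩ (fun y => f y - g y) ⁻¹' {0}ᶜ) ∪ (U ∩ interior {y | f y - g y = 0}), ?_,
    ho.union (hU.inter isOpen_interior), ?_, ?_⟩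
  · exact union_subset inter_subset_left inter_subset_left
  · refine measure_null_of_locally_null _ fun x hx => ?_
    obtain ⟨hxU, hxD⟩ := hx
    have hxi : x ∉ interior {y | f y - g y = 0} := fun hc => hxD (Or.inr ⟨hxU, hc⟩)
    obtain ⟨e, he, hball⟩ := Metric.isOpen_iff.1 hU x hxU
    obtain ⟨p, hpx, hp⟩ : ∃ p ∈ Metric.ball x (e / 4), f p - g p ≠ 0 := by
      by_contra hcon
      push Not at hcon
      exact hxi (mem_interior.2 ⟨_, hcon, Metric.isOpen_ball,
        Metric.mem_ball_self (by linarith)⟩)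
    have hsub : Metric.ball p (2 * (e / 4)) ⊆ U := by
      refine Subset.trans (Metric.ball_subset_ball' ?_) hball
      have := Metric.mem_ball.1 hpx
      linarith
    have hn := aux_null_zeros (fun y => f y - g y) p (e / 4) (by linarith) (hh.mono hsub) hp
    refine ⟨(U \ _) ∩ Metric.ball p (e / 4), Filter.inter_mem self_mem_nhdsWithin
      (mem_nhdsWithin_of_mem_nhds (Metric.isOpen_ball.mem_nhds ?_)), measure_mono_null ?_ hn⟩
    · rwa [Metric.mem_ball_comm]
    · rintro y ⟨⟨hyU, hyD⟩, hyb⟩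
      refine ⟨hyb, ?_⟩
      by_contra hc
      exact hyD (Or.inl ⟨hyU, hc⟩)
  · rintro x (⟨hxU, hx⟩ | ⟨hxU, hx⟩)
    · have hx' : f x - g x ≠ 0 := hx
      rcases lt_or_gt_of_ne (sub_ne_zero.1 hx') with hlt | hgt
      · refine (hg x hxU).congr ?_
        filter_upwards [(hf x hxU).continuousAt.eventually_lt (hg x hxU).continuousAt hlt]
          with y hy
        exact (max_eq_right hy.le).symm
      · refine (hf x hxU).congr ?_
        filter_upwards [(hg x hxU).continuousAt.eventually_lt (hf x hxU).continuousAt hgt]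
          with y hy
        exact (max_eq_left hy.le).symm
    · refine (hf x hxU).congr ?_
      filter_upwards [mem_interior_iff_mem_nhds.1 hx] with y hy
      exact (max_eq_left (sub_eq_zero.1 hy).ge).symm
end

section
/- Fix a,b ∈ ℝⁿ and x,x' ∈ [a,b], and let μ be a probability measure on the space of continuous functions [0,1] → ℝⁿ that is supported on the set of monotone, piecewise continuously differentiable paths from x' to x contained in [a,b]. Suppose that for every continuously differentiable F : [a,b] → ℝ the map γ ↦ A^γ(x,x',F) is μ-integrable, and define A(x,x',F) := ∫ A^γ(x,x',F) dμ(γ). Then A satisfies completeness, linearity, sensitivity(b), and non-decreasing positivity (NDP) at (x,x'). -/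
open MeasureTheory Set

theorem aux_cont {n : ℕ} {γ : ℝ → (Fin n → ℝ)} {F : (Fin n → ℝ) → ℝ}
    (hγ : ContinuousOn γ (Set.Icc 0 1)) (hF : ContDiff ℝ 1 F) (i : Fin n) :
    ContinuousOn (fun t => pderiv' F i (γ t)) (Set.Icc 0 1) := by
  have h : Continuous (fun y => pderiv' F i y) :=
    (hF.continuous_fderiv one_ne_zero).clm_apply continuous_const
  exact h.comp_continuousOn hγ

theorem aux_int {n : ℕ} {γ : ℝ → (Fin n → ℝ)} {F : (Fin n → ℝ) → ℝ} {x x' : Fin n → ℝ}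
    (hγ : IsPWC1Path γ x' x) (hF : ContDiff ℝ 1 F) (i : Fin n) :
    IntervalIntegrable (fun t => pderiv' F i (γ t) * deriv γ t i) volume 0 1 := by
  obtain ⟨hc, h0, h1, S, hd, hdc, hi⟩ := hγ
  have h2 : IntervalIntegrable (fun t => deriv γ t i) volume 0 1 := by
    rw [intervalIntegrable_iff] at hi ⊢
    exact (ContinuousLinearMap.proj (R := ℝ) (φ := fun _ : Fin n => ℝ) i).integrable_comp hi
  refine h2.continuousOn_mul ?_
  rw [Set.uIcc_of_le zero_le_one]
  exact aux_cont hc hF i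

theorem aux_complete {n : ℕ} {γ : ℝ → (Fin n → ℝ)} {F : (Fin n → ℝ) → ℝ} {x x' : Fin n → ℝ}
    (hγ : IsPWC1Path γ x' x) (hF : ContDiff ℝ 1 F) :
    ∑ i, pathAttr γ F i = F x - F x' := by
  unfold pathAttr
  rw [← intervalIntegral.integral_finsetSum (fun i _ => aux_int hγ hF i)]
  have hI : IntervalIntegrable (fun t => ∑ i, pderiv' F i (γ t) * deriv γ t i) volume 0 1 := by
    have := IntervalIntegrable.sum (μ := volume) (a := (0:ℝ)) (b := 1) Finset.univ
      (f := fun i t => pderiv' F i (γ t) * deriv γ t i) (fun i _ => aux_int hγ hF i)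
    have e : (∑ i, fun t => pderiv' F i (γ t) * deriv γ t i)
        = fun t => ∑ i, pderiv' F i (γ t) * deriv γ t i := by
      ext t; simp
    rw [e] at this
    exact this
  obtain ⟨hc, h0, h1, S, hd, hdc, hi⟩ := hγ
  have := integral_eq_of_hasDerivAt_off_countable_of_le (fun t => F (γ t))
    (fun t => ∑ i, pderiv' F i (γ t) * deriv γ t i) zero_le_one (s := (S : Set ℝ))
    S.countable_toSet (hF.continuous.comp_continuousOn hc) ?_ hI
  · rw [this, h0, h1]
  · intro t ht
    have h := ((hF.differentiable one_ne_zero) (γ t)).hasFDerivAt.comp_hasDerivAt t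
      (hd t ht).hasDerivAt
    have h' : HasDerivAt (fun t => F (γ t)) (fderiv ℝ F (γ t) (deriv γ t)) t := h
    suffices hs : ∑ i, pderiv' F i (γ t) * deriv γ t i = fderiv ℝ F (γ t) (deriv γ t) by
      simp only [hs]
      exact h'
    conv_rhs => rw [pi_eq_sum_univ' (deriv γ t)]
    rw [map_sum]
    refine Finset.sum_congr rfl fun i _ => ?_
    rw [map_smul, smul_eq_mul, mul_comm]
    unfold pderiv'
    congr 2

theorem aux_seg {n : ℕ} {F : (Fin n → ℝ) → ℝ} {x x' p q : Fin n → ℝ}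
    (hND : NonDecreasingFromTo F x' x)
    (hm : ∀ j, (x' j ≤ p j ∧ p j ≤ q j ∧ q j ≤ x j) ∨ (x j ≤ q j ∧ q j ≤ p j ∧ p j ≤ x' j)) :
    MonotoneOn (fun s : ℝ => F (p + s • (q - p))) (Set.Icc 0 1) := by
  let φ := Real.smoothTransition
  have hφ : ContDiff ℝ 1 φ := Real.smoothTransition.contDiff (n := 1)
  have hφm : Monotone φ := Real.smoothTransition.monotone
  let γ : ℝ → (Fin n → ℝ) := fun t =>
    x' + φ (3 * t) • (p - x') + φ (3 * t - 1) • (q - p) + φ (3 * t - 2) • (x - q)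
  have hγ : ContDiff ℝ 1 γ := by
    have e1 : ContDiff ℝ 1 (fun t : ℝ => φ (3 * t)) := hφ.comp (by fun_prop)
    have e2 : ContDiff ℝ 1 (fun t : ℝ => φ (3 * t - 1)) := hφ.comp (by fun_prop)
    have e3 : ContDiff ℝ 1 (fun t : ℝ => φ (3 * t - 2)) := hφ.comp (by fun_prop)
    exact (((contDiff_const.add (e1.smul contDiff_const)).add (e2.smul contDiff_const)).add
      (e3.smul contDiff_const))
  have hd : Continuous (deriv γ) := hγ.continuous_deriv le_rfl
  have z : ∀ t, t ≤ 0 → φ t = 0 := fun t h => Real.smoothTransition.zero_of_nonpos h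
  have o : ∀ t, 1 ≤ t → φ t = 1 := fun t h => Real.smoothTransition.one_of_one_le h
  have hp : IsPWC1Path γ x' x := by
    refine ⟨hγ.continuous.continuousOn, ?_, ?_, ∅, fun t _ => hγ.differentiable one_ne_zero t,
      hd.continuousOn, hd.intervalIntegrable _ _⟩
    · simp only [γ]
      rw [z _ (by norm_num), z _ (by norm_num), z _ (by norm_num)]; simp
    · simp only [γ]
      rw [o _ (by norm_num), o _ (by norm_num), o _ (by norm_num)]; simp
  have hmon : IsMonotonePath γ := by
    intro j
    have m1 : ∀ s t : ℝ, s ≤ t → φ (3 * s) ≤ φ (3 * t) := fun s t h => hφm (by linarith)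
    have m2 : ∀ s t : ℝ, s ≤ t → φ (3 * s - 1) ≤ φ (3 * t - 1) := fun s t h => hφm (by linarith)
    have m3 : ∀ s t : ℝ, s ≤ t → φ (3 * s - 2) ≤ φ (3 * t - 2) := fun s t h => hφm (by linarith)
    rcases hm j with ⟨a1, a2, a3⟩ | ⟨a1, a2, a3⟩
    · left
      intro s _ t _ hst
      simp only [γ, Pi.add_apply, Pi.smul_apply, Pi.sub_apply, smul_eq_mul]
      nlinarith [mul_nonneg (sub_nonneg.2 (m1 s t hst)) (sub_nonneg.2 a1),
        mul_nonneg (sub_nonneg.2 (m2 s t hst)) (sub_nonneg.2 a2),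
        mul_nonneg (sub_nonneg.2 (m3 s t hst)) (sub_nonneg.2 a3)]
    · right
      intro s _ t _ hst
      simp only [γ, Pi.add_apply, Pi.smul_apply, Pi.sub_apply, smul_eq_mul]
      nlinarith [mul_nonneg (sub_nonneg.2 (m1 s t hst)) (sub_nonneg.2 a3),
        mul_nonneg (sub_nonneg.2 (m2 s t hst)) (sub_nonneg.2 a2),
        mul_nonneg (sub_nonneg.2 (m3 s t hst)) (sub_nonneg.2 a1)]
  have key := hND γ hp hmon
  have hsurj : ∀ s ∈ Set.Icc (0:ℝ) 1, ∃ u ∈ Set.Icc (0:ℝ) 1, φ u = s := by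
    intro s hs
    have := intermediate_value_Icc (zero_le_one (α := ℝ)) (f := φ) hφ.continuous.continuousOn
    rw [z 0 le_rfl, o 1 le_rfl] at this
    exact this hs
  have hval : ∀ u ∈ Set.Icc (0:ℝ) 1, γ ((u + 1) / 3) = p + φ u • (q - p) := by
    intro u hu
    simp only [γ]
    rw [o (3 * ((u + 1) / 3)) (by linarith [hu.1]), z (3 * ((u + 1) / 3) - 2) (by linarith [hu.2]),
      show 3 * ((u + 1) / 3) - 1 = u by ring]
    simp
  intro s hs t ht hst
  rcases hst.eq_or_lt with rfl | hlt
  · exact le_rfl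
  obtain ⟨u, hu, rfl⟩ := hsurj s hs
  obtain ⟨v, hv, rfl⟩ := hsurj t ht
  have huv : u ≤ v := by
    by_contra h
    exact absurd (hφm (not_le.1 h).le) (not_le.2 hlt)
  have := key (a := (u + 1) / 3) ⟨by linarith [hu.1], by linarith [hu.2]⟩
    (b := (v + 1) / 3) ⟨by linarith [hv.1], by linarith [hv.2]⟩ (by linarith)
  simp only [hval u hu, hval v hv] at this
  exact this

theorem aux_sign {n : ℕ} {F : (Fin n → ℝ) → ℝ} {x x' y : Fin n → ℝ} (hF : ContDiff ℝ 1 F)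
    (hND : NonDecreasingFromTo F x' x)
    (hy : ∀ j, (x' j ≤ y j ∧ y j ≤ x j) ∨ (x j ≤ y j ∧ y j ≤ x' j)) (i : Fin n) :
    0 ≤ (x i - x' i) * pderiv' F i y := by
  by_cases hxi : x i = x' i
  · simp [hxi]
  let p := Function.update y i (x' i)
  let q := Function.update y i (x i)
  have hmono := aux_seg (p := p) (q := q) hND (by
    intro j
    by_cases hj : j = i
    · subst hj
      simp only [p, q, Function.update_self]
      rcases hy j with h | h
      · left; exact ⟨le_rfl, h.1.trans h.2, le_rfl⟩
      · right; exact ⟨le_rfl, h.1.trans h.2, le_rfl⟩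
    · simp only [p, q, Function.update_of_ne hj]
      rcases hy j with h | h
      · left; exact ⟨h.1, le_rfl, h.2⟩
      · right; exact ⟨h.1, le_rfl, h.2⟩)
  have hqp : q - p = (x i - x' i) • (Pi.single i 1 : Fin n → ℝ) := by
    ext j
    by_cases hj : j = i
    · subst hj; simp [p, q]
    · simp [p, q, hj]
  have hne : x i - x' i ≠ 0 := sub_ne_zero.2 hxi
  let s := (y i - x' i) / (x i - x' i)
  have hs : s ∈ Set.Icc (0:ℝ) 1 := by
    rcases hy i with h | h
    · have : 0 < x i - x' i := lt_of_le_of_ne (by linarith) hne.symm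
      exact ⟨div_nonneg (by linarith) this.le, (div_le_one this).2 (by linarith)⟩
    · have : x i - x' i < 0 := lt_of_le_of_ne (by linarith) hne
      exact ⟨div_nonneg_of_nonpos (by linarith) this.le, (div_le_one_of_neg this).2 (by linarith)⟩
  have hys : p + s • (q - p) = y := by
    rw [hqp, smul_smul, div_mul_cancel₀ _ hne]
    ext j
    by_cases hj : j = i
    · subst hj; simp [p]
    · simp [p, hj]
  have hder : HasDerivAt (fun s : ℝ => F (p + s • (q - p))) (fderiv ℝ F y (q - p)) s := by
    have h1 : HasDerivAt (fun s : ℝ => p + s • (q - p)) (q - p) s := by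
      simpa using ((hasDerivAt_id s).smul_const (q - p)).const_add p
    have h2 := ((hF.differentiable one_ne_zero) (p + s • (q - p))).hasFDerivAt.comp_hasDerivAt s h1
    rw [hys] at h2
    exact h2
  have h3 := hmono.derivWithin_nonneg (x := s)
  rw [(hder.hasDerivWithinAt).derivWithin (uniqueDiffOn_Icc zero_lt_one s hs), hqp, map_smul,
    smul_eq_mul] at h3
  exact h3

theorem aux_ndp {n : ℕ} {γ : ℝ → (Fin n → ℝ)} {F : (Fin n → ℝ) → ℝ} {x x' : Fin n → ℝ}
    (hγ : IsPWC1Path γ x' x) (hm : IsMonotonePath γ) (hF : ContDiff ℝ 1 F)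
    (hND : NonDecreasingFromTo F x' x) (i : Fin n) : 0 ≤ pathAttr γ F i := by
  obtain ⟨hc, h0, h1, -⟩ := hγ
  have m0 : (0:ℝ) ∈ Set.Icc (0:ℝ) 1 := by simp
  have m1 : (1:ℝ) ∈ Set.Icc (0:ℝ) 1 := by simp
  unfold pathAttr
  rw [intervalIntegral.integral_of_le zero_le_one, integral_Ioc_eq_integral_Ioo]
  refine setIntegral_nonneg measurableSet_Ioo fun t ht => ?_
  by_cases hd : DifferentiableAt ℝ γ t
  swap
  · simp [deriv_zero_of_not_differentiableAt hd]
  have htI : t ∈ Set.Icc (0:ℝ) 1 := Ioo_subset_Icc_self ht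
  have hy : ∀ j, (x' j ≤ γ t j ∧ γ t j ≤ x j) ∨ (x j ≤ γ t j ∧ γ t j ≤ x' j) := by
    intro j
    rw [← h0, ← h1]
    rcases hm j with h | h
    · exact Or.inl ⟨h m0 htI ht.1.le, h htI m1 ht.2.le⟩
    · exact Or.inr ⟨h htI m1 ht.2.le, h m0 htI ht.1.le⟩
  have hs := aux_sign hF hND hy i
  have hdi : HasDerivAt (fun s => γ s i) (deriv γ t i) t := hasDerivAt_pi.1 hd.hasDerivAt i
  have hdw : derivWithin (fun s => γ s i) (Set.Icc 0 1) t = deriv γ t i :=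
    hdi.hasDerivWithinAt.derivWithin (uniqueDiffOn_Icc zero_lt_one t htI)
  by_cases hxi : x i = x' i
  · have hconst : ∀ s ∈ Set.Icc (0:ℝ) 1, γ s i = x i := by
      intro s hs
      rcases hm i with h | h
      · have a1 := h m0 hs hs.1
        have a2 := h hs m1 hs.2
        simp only [h0, h1] at a1 a2
        linarith
      · have a1 := h m0 hs hs.1
        have a2 := h hs m1 hs.2
        simp only [h0, h1] at a1 a2
        linarith
    have : derivWithin (fun s => γ s i) (Set.Icc 0 1) t = 0 := by
      rw [derivWithin_congr (f := fun _ => x i) hconst (hconst t htI)]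
      simp
    rw [← hdw, this, mul_zero]
  · rcases hm i with h | h
    · have a1 := h m0 m1 zero_le_one
      simp only [h0, h1] at a1
      have a2 : 0 < x i - x' i := sub_pos.2 (lt_of_le_of_ne a1 (Ne.symm hxi))
      have a3 := h.derivWithin_nonneg (x := t)
      rw [hdw] at a3
      exact mul_nonneg (nonneg_of_mul_nonneg_right hs a2) a3
    · have a1 := h m0 m1 zero_le_one
      simp only [h0, h1] at a1
      have a2 : x i - x' i < 0 := sub_neg.2 (lt_of_le_of_ne a1 hxi)
      have a3 := h.derivWithin_nonpos (x := t)
      rw [hdw] at a3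
      refine mul_nonneg_of_nonpos_of_nonpos ?_ a3
      by_contra hh
      exact absurd hs (not_le.2 (mul_neg_of_neg_of_pos a2 (not_le.1 hh)))

/-- an ensemble of monotone path methods (an average over a probability
distribution of monotone piecewise-C¹ paths from `x'` to `x` inside `[a,b]`) satisfies
completeness, linearity, sensitivity(b), and NDP at `(x,x')`. -/
theorem ensemble_of_monotone_path_methods_satisfies_axioms {n : ℕ}
    (a b x x' : Fin n → ℝ) (hx : x ∈ Box a b) (hx' : x' ∈ Box a b)
    (Ω : Type*) [MeasurableSpace Ω] (μ : Measure Ω) [IsProbabilityMeasure μ]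
    (Γ : Ω → ℝ → (Fin n → ℝ))
    (hΓ : ∀ ω, IsPWC1Path (Γ ω) x' x ∧ IsMonotonePath (Γ ω) ∧
      ∀ t ∈ Set.Icc (0:ℝ) 1, Γ ω t ∈ Box a b)
    (A : ((Fin n → ℝ) → ℝ) → (Fin n → ℝ))
    (hA : ∀ F : (Fin n → ℝ) → ℝ, A F = fun i => ∫ ω, pathAttr (Γ ω) F i ∂μ)
    (hint : ∀ F : (Fin n → ℝ) → ℝ, ContDiff ℝ 1 F → ∀ i,
      Integrable (fun ω => pathAttr (Γ ω) F i) μ) :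
    -- completeness
    (∀ F : (Fin n → ℝ) → ℝ, ContDiff ℝ 1 F → ∑ i, A F i = F x - F x') ∧
    -- linearity
    (∀ F G : (Fin n → ℝ) → ℝ, ContDiff ℝ 1 F → ContDiff ℝ 1 G → ∀ α β : ℝ,
      A (fun y => α * F y + β * G y) = fun i => α * A F i + β * A G i) ∧
    -- sensitivity(b)
    (∀ F : (Fin n → ℝ) → ℝ, ContDiff ℝ 1 F → ∀ i,
      (∀ y ∈ Box a b, pderiv' F i y = 0) → A F i = 0) ∧
    -- NDP
    (∀ F : (Fin n → ℝ) → ℝ, ContDiff ℝ 1 F → NonDecreasingFromTo F x' x →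
      ∀ i, 0 ≤ A F i) := by
  refine ⟨?_, ?_, ?_, ?_⟩
  · intro F hF
    simp only [hA]
    rw [← integral_finsetSum _ (fun i _ => hint F hF i)]
    simp only [fun ω => aux_complete (hΓ ω).1 hF]
    simp
  · intro F G hF hG α β
    have hp : ∀ ω i, pathAttr (Γ ω) (fun y => α * F y + β * G y) i
        = α * pathAttr (Γ ω) F i + β * pathAttr (Γ ω) G i := by
      intro ω i
      unfold pathAttr
      rw [← intervalIntegral.integral_const_mul, ← intervalIntegral.integral_const_mul,
        ← intervalIntegral.integral_add ((aux_int (hΓ ω).1 hF i).const_mul α)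
          ((aux_int (hΓ ω).1 hG i).const_mul β)]
      congr 1
      ext t
      have hFd := ((hF.differentiable one_ne_zero) (Γ ω t)).hasFDerivAt
      have hGd := ((hG.differentiable one_ne_zero) (Γ ω t)).hasFDerivAt
      have h := ((hFd.const_mul α).add (hGd.const_mul β)).fderiv
      have h' : fderiv ℝ (fun y => α * F y + β * G y) (Γ ω t) = _ := h
      simp only [pderiv', h']
      simp
      ring
    rw [hA, hA, hA]
    ext i
    simp only [hp]
    rw [integral_add ((hint F hF i).const_mul α) ((hint G hG i).const_mul β),
      integral_const_mul, integral_const_mul]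
  · intro F hF i h
    rw [hA]
    have : ∀ ω, pathAttr (Γ ω) F i = 0 := by
      intro ω
      unfold pathAttr
      rw [intervalIntegral.integral_congr (g := fun _ => (0:ℝ))]
      · simp
      · intro t ht
        rw [Set.uIcc_of_le zero_le_one] at ht
        simp [h _ ((hΓ ω).2.2 t ht)]
    simp [this]
  · intro F hF hND i
    rw [hA]
    exact integral_nonneg fun ω => aux_ndp (hΓ ω).1 (hΓ ω).2.1 hF hND i
end

section
/- Let A be a baseline attribution method on the class of continuously differentiable functions [a,b] → ℝ that satisfies completeness, linearity, sensitivity(b), and non-decreasing positivity (NDP). Then A(x,x',F) is determined by x, x', and the restriction of F to the sub-hyperrectangle [x,x']: if G, H are continuously differentiable on [a,b] and G(y) = H(y) for all y ∈ [x,x'], then A(x,x',G) = A(x,x',H). -/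
open MeasureTheory Set

/-- locality: a BAM on C¹ functions satisfying completeness, linearity,
sensitivity(b), and NDP is determined by the restriction of `F` to `[x,x']`. -/
theorem attribution_determined_on_subbox {n : ℕ} (a b : Fin n → ℝ)
    (A : (Fin n → ℝ) → (Fin n → ℝ) → ((Fin n → ℝ) → ℝ) → (Fin n → ℝ))
    (hcomp : ∀ x x', x ∈ Box a b → x' ∈ Box a b → ∀ F : (Fin n → ℝ) → ℝ,
      ContDiff ℝ 1 F → ∑ i, A x x' F i = F x - F x')
    (hlin : ∀ x x', x ∈ Box a b → x' ∈ Box a b →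
      ∀ F G : (Fin n → ℝ) → ℝ, ContDiff ℝ 1 F → ContDiff ℝ 1 G → ∀ α β : ℝ,
        A x x' (fun y => α * F y + β * G y) = fun i => α * A x x' F i + β * A x x' G i)
    (hdummy : ∀ x x', x ∈ Box a b → x' ∈ Box a b → ∀ F : (Fin n → ℝ) → ℝ,
      ContDiff ℝ 1 F → ∀ i, (∀ y ∈ Box a b, pderiv' F i y = 0) → A x x' F i = 0)
    (hndp : ∀ x x', x ∈ Box a b → x' ∈ Box a b → ∀ F : (Fin n → ℝ) → ℝ,
      ContDiff ℝ 1 F → NonDecreasingFromTo F x' x → ∀ i, 0 ≤ A x x' F i)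
    (x x' : Fin n → ℝ) (hx : x ∈ Box a b) (hx' : x' ∈ Box a b)
    (G H : (Fin n → ℝ) → ℝ) (hG : ContDiff ℝ 1 G) (hH : ContDiff ℝ 1 H)
    (hGH : ∀ y ∈ Box x x', G y = H y) :
    A x x' G = A x x' H := by
  have hbox : ∀ γ : ℝ → (Fin n → ℝ), IsPWC1Path γ x' x → IsMonotonePath γ →
      ∀ t ∈ Set.Icc (0:ℝ) 1, γ t ∈ Box x x' := by
    intro γ hγ hm t ht i
    obtain ⟨-, h0, h1, -⟩ := hγ
    have z0 : (0:ℝ) ∈ Set.Icc (0:ℝ) 1 := ⟨le_rfl, zero_le_one⟩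
    have z1 : (1:ℝ) ∈ Set.Icc (0:ℝ) 1 := ⟨zero_le_one, le_rfl⟩
    rcases hm i with h | h
    · have e0 := h z0 ht ht.1
      have e1 := h ht z1 ht.2
      simp only [h0, h1] at e0 e1
      exact ⟨(min_le_right _ _).trans e0, e1.trans (le_max_left _ _)⟩
    · have e0 := h z0 ht ht.1
      have e1 := h ht z1 ht.2
      simp only [h0, h1] at e0 e1
      exact ⟨(min_le_left _ _).trans e1, e0.trans (le_max_right _ _)⟩
  have key : ∀ P Q : (Fin n → ℝ) → ℝ, ContDiff ℝ 1 P → ContDiff ℝ 1 Q →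
      (∀ y ∈ Box x x', P y = Q y) → ∀ i, A x x' Q i ≤ A x x' P i := by
    intro P Q hP hQ hPQ i
    have hc : ContDiff ℝ 1 (fun y => (1:ℝ) * P y + (-1) * Q y) :=
      (contDiff_const.mul hP).add (contDiff_const.mul hQ)
    have h := hndp x x' hx hx' _ hc (by
      intro γ hγ hm s hs t ht _
      have e1 := hPQ _ (hbox γ hγ hm s hs)
      have e2 := hPQ _ (hbox γ hγ hm t ht)
      simp only [e1, e2]
      linarith) i
    rw [hlin x x' hx hx' P Q hP hQ 1 (-1)] at h
    linarith
  funext i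
  exact le_antisymm (key H G hH hG (fun y hy => (hGH y hy).symm) i) (key G H hG hH hGH i)
end

section
/- Let A be a baseline attribution method on a class of Lipschitz continuous functions [a,b] → ℝ (containing all affine functions) that satisfies linearity, completeness, sensitivity(b), and non-decreasing positivity (NDP). Suppose F : [a,b] → ℝ is Lipschitz continuous and non-decreasing from x' to x in its i-th component, meaning that for every y ∈ [x,x'] the map t ↦ F(ℓ^{(y,i)}(t)), t ∈ [0, |xᵢ − x'ᵢ|], is non-decreasing, where ℓ^{(y,i)}ᵢ(t) = x'ᵢ + sign(xᵢ − x'ᵢ)·t and ℓ^{(y,i)}ⱼ(t) = yⱼ for j ≠ i. Then Aᵢ(x,x',F) ≥ 0. -/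
open MeasureTheory Set

/-- Along a monotone function from `u 0` to `u 1`, increments carry the sign of `u 1 - u 0`. -/
theorem sign_aux (u : ℝ → ℝ) (hu : MonotoneOn u (Set.Icc 0 1) ∨ AntitoneOn u (Set.Icc 0 1))
    (s t : ℝ) (hs : s ∈ Set.Icc (0:ℝ) 1) (ht : t ∈ Set.Icc (0:ℝ) 1) (hst : s ≤ t) :
    Real.sign (u 1 - u 0) * (u t - u s) = |u t - u s| ∧
      Real.sign (u 1 - u 0) * |u t - u s| = u t - u s := by
  have h0 : (0:ℝ) ∈ Set.Icc (0:ℝ) 1 := by simp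
  have h1 : (1:ℝ) ∈ Set.Icc (0:ℝ) 1 := by simp
  rcases hu with hu | hu
  · have e1 := hu h0 hs hs.1
    have e2 := hu hs ht hst
    have e3 := hu ht h1 ht.2
    rcases eq_or_lt_of_le (e1.trans (e2.trans e3)) with h | h
    · have : u t = u s := by linarith
      simp [this]
    · rw [Real.sign_of_pos (by linarith), abs_of_nonneg (by linarith)]
      constructor <;> ring
  · have e1 := hu h0 hs hs.1
    have e2 := hu hs ht hst
    have e3 := hu ht h1 ht.2
    rcases eq_or_lt_of_le (e3.trans (e2.trans e1)) with h | h
    · have : u t = u s := by linarith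
      simp [this]
    · rw [Real.sign_of_neg (by linarith), abs_of_nonpos (by linarith)]
      constructor <;> ring

/-- Values of a monotone function stay between its end values. -/
theorem box_aux (u : ℝ → ℝ) (hu : MonotoneOn u (Set.Icc 0 1) ∨ AntitoneOn u (Set.Icc 0 1))
    (t : ℝ) (ht : t ∈ Set.Icc (0:ℝ) 1) :
    min (u 1) (u 0) ≤ u t ∧ u t ≤ max (u 1) (u 0) := by
  have h0 : (0:ℝ) ∈ Set.Icc (0:ℝ) 1 := by simp
  have h1 : (1:ℝ) ∈ Set.Icc (0:ℝ) 1 := by simp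
  rcases hu with hu | hu
  · have e1 := hu h0 ht ht.1
    have e3 := hu ht h1 ht.2
    exact ⟨(min_le_right _ _).trans e1, e3.trans (le_max_left _ _)⟩
  · have e1 := hu h0 ht ht.1
    have e3 := hu ht h1 ht.2
    exact ⟨(min_le_left _ _).trans e3, e1.trans (le_max_right _ _)⟩

/-- Lemma 4: if a BAM on Lipschitz functions satisfies linearity,
completeness, sensitivity(b), and NDP, and `F` is Lipschitz and non-decreasing from `x'`
to `x` in its `i`-th component, then `Aᵢ(x,x',F) ≥ 0`. -/
theorem componentwise_nondecreasing_nonneg_attr {n : ℕ} (a b : Fin n → ℝ)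
    (A : (Fin n → ℝ) → (Fin n → ℝ) → ((Fin n → ℝ) → ℝ) → (Fin n → ℝ))
    (hlin : ∀ x x', x ∈ Box a b → x' ∈ Box a b →
      ∀ F G : (Fin n → ℝ) → ℝ, (∃ K, LipschitzWith K F) → (∃ K, LipschitzWith K G) →
        ∀ α β : ℝ,
          A x x' (fun y => α * F y + β * G y) = fun k => α * A x x' F k + β * A x x' G k)
    (hcomp : ∀ x x', x ∈ Box a b → x' ∈ Box a b → ∀ F : (Fin n → ℝ) → ℝ,
      (∃ K, LipschitzWith K F) → ∑ k, A x x' F k = F x - F x')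
    (hdummy : ∀ x x', x ∈ Box a b → x' ∈ Box a b → ∀ F : (Fin n → ℝ) → ℝ,
      (∃ K, LipschitzWith K F) → ∀ k,
        (∀ y ∈ Box a b, ∀ c : ℝ, Function.update y k c ∈ Box a b →
          F (Function.update y k c) = F y) →
        A x x' F k = 0)
    (hndp : ∀ x x', x ∈ Box a b → x' ∈ Box a b → ∀ F : (Fin n → ℝ) → ℝ,
      (∃ K, LipschitzWith K F) → NonDecreasingFromTo F x' x → ∀ k, 0 ≤ A x x' F k)
    (x x' : Fin n → ℝ) (hx : x ∈ Box a b) (hx' : x' ∈ Box a b)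
    (i : Fin n) (F : (Fin n → ℝ) → ℝ) (hF : ∃ K, LipschitzWith K F)
    (hmono : ∀ y ∈ Box x x',
      MonotoneOn (fun t => F (Function.update y i (x' i + Real.sign (x i - x' i) * t)))
        (Set.Icc 0 |x i - x' i|)) :
    0 ≤ A x x' F i := by
  obtain ⟨K, hK⟩ := hF
  set c : Fin n → ℝ := fun j => if j = i then 0 else K * Real.sign (x j - x' j) with hc
  set L : (Fin n → ℝ) → ℝ := fun y => ∑ j, c j * y j with hL
  have hLlip : ∃ K, LipschitzWith K L := by
    refine ⟨_, LipschitzWith.of_dist_le_mul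
      (K := ‖(∑ j, c j • (ContinuousLinearMap.proj j : (Fin n → ℝ) →L[ℝ] ℝ))‖₊) ?_⟩
    intro y z
    have := (∑ j, c j • (ContinuousLinearMap.proj j : (Fin n → ℝ) →L[ℝ] ℝ)).lipschitz.dist_le_mul y z
    simpa [hL] using this
  have hLi : A x x' L i = 0 := by
    refine hdummy x x' hx hx' L hLlip i ?_
    intro y _ d _
    refine Finset.sum_congr rfl fun j _ => ?_
    by_cases hj : j = i
    · simp [hc, hj]
    · simp [hj]
  have hGlip : ∃ K, LipschitzWith K (fun y => 1 * F y + 1 * L y) := by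
    obtain ⟨K', hK'⟩ := hLlip
    exact ⟨K + K', by simpa using hK.add hK'⟩
  have hG : NonDecreasingFromTo (fun y => 1 * F y + 1 * L y) x' x := by
    rintro γ ⟨_, hγ0, hγ1, _⟩ hγ s hs t ht hst
    have h0 : (0:ℝ) ∈ Set.Icc (0:ℝ) 1 := by simp
    have h1 : (1:ℝ) ∈ Set.Icc (0:ℝ) 1 := by simp
    have hsg : ∀ j, ∀ s ∈ Set.Icc (0:ℝ) 1, ∀ t ∈ Set.Icc (0:ℝ) 1, s ≤ t →
        Real.sign (x j - x' j) * (γ t j - γ s j) = |γ t j - γ s j| ∧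
        Real.sign (x j - x' j) * |γ t j - γ s j| = γ t j - γ s j := by
      intro j s hs t ht hst
      have := sign_aux (fun t => γ t j) (hγ j) s t hs ht hst
      simpa only [hγ0, hγ1] using this
    have hbox : γ t ∈ Box x x' := by
      intro j
      have := box_aux (fun t => γ t j) (hγ j) t ht
      simpa only [hγ0, hγ1] using this
    have hA : F (Function.update (γ t) i (γ s i)) ≤ F (γ t) := by
      have e1 := hsg i 0 h0 s hs hs.1
      have e2 := hsg i s hs t ht hst
      have e3 := hsg i t ht 1 h1 ht.2
      have e4 := hsg i 0 h0 t ht ht.1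
      have e5 := hsg i 0 h0 1 h1 zero_le_one
      rw [hγ0] at e1 e4 e5
      rw [hγ1] at e3 e5
      have a2 := abs_nonneg (γ t i - γ s i)
      have a3 := abs_nonneg (x i - γ t i)
      have l1 : |γ s i - x' i| ≤ |γ t i - x' i| := by
        rw [← e1.1, ← e4.1]; rw [← e2.1] at a2; linarith
      have l2 : |γ t i - x' i| ≤ |x i - x' i| := by
        rw [← e4.1, ← e5.1]; rw [← e3.1] at a3; linarith
      have := hmono (γ t) hbox (a := |γ s i - x' i|) (b := |γ t i - x' i|)
        ⟨abs_nonneg _, l1.trans l2⟩ ⟨abs_nonneg _, l2⟩ l1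
      simp only [e1.2, e4.2, add_sub_cancel, Function.update_eq_self] at this
      exact this
    have hLd : L (γ t) - L (γ s) = K * ∑ j, (if j = i then 0 else |γ t j - γ s j|) := by
      simp only [hL]
      rw [← Finset.sum_sub_distrib, Finset.mul_sum]
      refine Finset.sum_congr rfl fun j _ => ?_
      by_cases hj : j = i
      · simp [hc, hj]
      · simp only [hc, hj, if_false]
        rw [← (hsg j s hs t ht hst).1]; ring
    have hB : F (γ s) - F (Function.update (γ t) i (γ s i)) ≤
        K * ∑ j, (if j = i then 0 else |γ t j - γ s j|) := by
      have hd := hK.dist_le_mul (γ s) (Function.update (γ t) i (γ s i))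
      rw [Real.dist_eq] at hd
      refine (le_abs_self _).trans (hd.trans ?_)
      refine mul_le_mul_of_nonneg_left ?_ K.2
      have hnn : ∀ j ∈ Finset.univ, 0 ≤ (if j = i then 0 else |γ t j - γ s j|) := by
        intro j _
        split_ifs
        · exact le_rfl
        · exact abs_nonneg _
      refine (dist_pi_le_iff (Finset.sum_nonneg hnn)).2 fun j => ?_
      refine le_trans ?_ (Finset.single_le_sum hnn (Finset.mem_univ j))
      by_cases hj : j = i
      · subst hj; simp
      · simp [hj, Real.dist_eq, abs_sub_comm]
    show 1 * F (γ s) + 1 * L (γ s) ≤ 1 * F (γ t) + 1 * L (γ t)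
    linarith
  have h := hndp x x' hx hx' _ hGlip hG i
  rw [hlin x x' hx hx' F L ⟨K, hK⟩ hLlip 1 1] at h
  simpa [hLi] using h
end

section
/- Let F : ℝ² → ℝ be defined by F(y₁,y₂) = max(y₂ − y₁, y₁ − y₂) and fix the baseline x' = (0,0). Then the map x ↦ IG(x,x',F) is not Lipschitz continuous: for every ε > 0, the points x = (1, 1 + ε/2) and x̄ = (1, 1 − ε/2) satisfy ‖x − x̄‖ = ε while |IG₁(x,x',F) − IG₁(x̄,x',F)| = 2. -/
open MeasureTheory Set

/-- Integrated gradients on `ℝⁿ` with the Euclidean norm: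
`IGᵢ(x,x',F) = (xᵢ - x'ᵢ) ∫₀¹ ∂F/∂xᵢ(x' + t(x - x')) dt`. -/
noncomputable def IGe {n : ℕ} (F : EuclideanSpace ℝ (Fin n) → ℝ) (i : Fin n)
    (x x' : EuclideanSpace ℝ (Fin n)) : ℝ :=
  (x i - x' i) *
    ∫ t in (0:ℝ)..1, fderiv ℝ F (x' + t • (x - x')) (EuclideanSpace.single i 1)

/-- `F(y₁,y₂) = max (y₂ - y₁) (y₁ - y₂)`. -/
noncomputable def Fmax : EuclideanSpace ℝ (Fin 2) → ℝ := fun y =>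
  max (y 1 - y 0) (y 0 - y 1)

lemma fderiv_Fmax_of_lt (y : EuclideanSpace ℝ (Fin 2)) (h : y 0 < y 1) :
    fderiv ℝ Fmax y (EuclideanSpace.single 0 1) = -1 := by
  let L : EuclideanSpace ℝ (Fin 2) →L[ℝ] ℝ :=
    EuclideanSpace.proj (1 : Fin 2) - EuclideanSpace.proj (0 : Fin 2)
  have hL : ∀ z, L z = z 1 - z 0 := fun z => by simp [L]
  have h1 : Fmax =ᶠ[nhds y] L := by
    have ho : IsOpen {z : EuclideanSpace ℝ (Fin 2) | z 0 < z 1} :=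
      isOpen_lt (by fun_prop) (by fun_prop)
    filter_upwards [ho.mem_nhds h] with z hz
    have hz' : z 0 < z 1 := hz
    rw [hL]
    exact max_eq_left (by linarith)
  rw [h1.fderiv_eq, L.fderiv, hL]
  simp

lemma fderiv_Fmax_of_gt (y : EuclideanSpace ℝ (Fin 2)) (h : y 1 < y 0) :
    fderiv ℝ Fmax y (EuclideanSpace.single 0 1) = 1 := by
  let L : EuclideanSpace ℝ (Fin 2) →L[ℝ] ℝ :=
    EuclideanSpace.proj (0 : Fin 2) - EuclideanSpace.proj (1 : Fin 2)
  have hL : ∀ z, L z = z 0 - z 1 := fun z => by simp [L]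
  have h1 : Fmax =ᶠ[nhds y] L := by
    have ho : IsOpen {z : EuclideanSpace ℝ (Fin 2) | z 1 < z 0} :=
      isOpen_lt (by fun_prop) (by fun_prop)
    filter_upwards [ho.mem_nhds h] with z hz
    have hz' : z 1 < z 0 := hz
    rw [hL]
    exact max_eq_right (by linarith)
  rw [h1.fderiv_eq, L.fderiv, hL]
  simp

lemma integral_const_aux (f : ℝ → ℝ) (c : ℝ) (h : ∀ t, 0 < t → f t = c) :
    ∫ t in (0:ℝ)..1, f t = c := by
  have : ∫ t in (0:ℝ)..1, f t = ∫ t in (0:ℝ)..1, c := by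
    apply intervalIntegral.integral_congr_ae
    filter_upwards with t ht
    rw [uIoc_of_le zero_le_one] at ht
    exact h t ht.1
  rw [this]
  simp

lemma IGe_of_lt (x : EuclideanSpace ℝ (Fin 2)) (h : x 0 < x 1) :
    IGe Fmax 0 x 0 = - x 0 := by
  unfold IGe
  rw [integral_const_aux _ (-1)]
  · simp
  · intro t ht
    apply fderiv_Fmax_of_lt
    simpa using mul_lt_mul_of_pos_left h ht

lemma IGe_of_gt (x : EuclideanSpace ℝ (Fin 2)) (h : x 1 < x 0) :
    IGe Fmax 0 x 0 = x 0 := by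
  unfold IGe
  rw [integral_const_aux _ 1]
  · simp
  · intro t ht
    apply fderiv_Fmax_of_gt
    simpa using mul_lt_mul_of_pos_left h ht

lemma IG_points (ε : ℝ) (hε : 0 < ε) (x xb : EuclideanSpace ℝ (Fin 2))
    (h0 : x 0 = 1) (h1 : x 1 = 1 + ε / 2) (hb0 : xb 0 = 1) (hb1 : xb 1 = 1 - ε / 2) :
    ‖x - xb‖ = ε ∧ |IGe Fmax 0 x 0 - IGe Fmax 0 xb 0| = 2 := by
  constructor
  · rw [EuclideanSpace.norm_eq, Fin.sum_univ_two]
    simp only [PiLp.sub_apply, h0, h1, hb0, hb1, Real.norm_eq_abs, sq_abs]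
    rw [show ((1:ℝ) - 1) ^ 2 + (1 + ε / 2 - (1 - ε / 2)) ^ 2 = ε ^ 2 by ring]
    exact Real.sqrt_sq hε.le
  · rw [IGe_of_lt x (by linarith), IGe_of_gt xb (by linarith), h0, hb0]
    norm_num

/-- `x ↦ IG(x,x',Fmax)` with baseline `x' = (0,0)` is not Lipschitz:
points `x = (1, 1+ε/2)` and `x̄ = (1, 1-ε/2)` are at Euclidean distance `ε` but their
first IG components differ by `2`. -/
theorem IG_not_lipschitz :
    (¬ ∃ K : NNReal, LipschitzWith K (fun x : EuclideanSpace ℝ (Fin 2) =>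
      (WithLp.equiv 2 (Fin 2 → ℝ)).symm (fun i => IGe Fmax i x 0))) ∧
    ∀ ε : ℝ, 0 < ε → ∀ x xb : EuclideanSpace ℝ (Fin 2),
      x 0 = 1 → x 1 = 1 + ε / 2 → xb 0 = 1 → xb 1 = 1 - ε / 2 →
      ‖x - xb‖ = ε ∧ |IGe Fmax 0 x 0 - IGe Fmax 0 xb 0| = 2 := by
  refine ⟨?_, IG_points⟩
  rintro ⟨K, hK⟩
  have hε : (0:ℝ) < 1 / (K + 1) := by positivity
  obtain ⟨hd, hI⟩ := IG_points (1 / (K + 1)) hε !₂[1, 1 + 1 / (K + 1) / 2]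
    !₂[1, 1 - 1 / (K + 1) / 2] (by simp) (by simp) (by simp) (by simp)
  have h := hK.dist_le_mul !₂[1, 1 + 1 / ((K:ℝ) + 1) / 2] !₂[1, 1 - 1 / ((K:ℝ) + 1) / 2]
  rw [dist_eq_norm, dist_eq_norm, hd] at h
  have h2 := (PiLp.norm_apply_le _ (0 : Fin 2)).trans h
  have h3 : (2:ℝ) ≤ K * (1 / (K + 1)) := by
    rw [← hI]
    exact h2
  rw [mul_one_div, le_div_iff₀ (by positivity)] at h3
  have := K.coe_nonneg
  linarith
end

section
/- Let F : [a,b] → ℝ be continuously differentiable, suppose ∇F is Lipschitz continuous on [a,b] with constant L (with respect to the Euclidean norm), let M = max_{y ∈ [a,b]} |(∂F/∂xᵢ)(y)|, and fix x' ∈ [a,b]. Then the map x ↦ IGᵢ(x,x',F) is Lipschitz continuous on [a,b] with Lipschitz constant at most M + (|bᵢ − aᵢ|/2)·L, i.e., |IGᵢ(x,x',F) − IGᵢ(x̄,x',F)| ≤ (M + (|bᵢ − aᵢ|/2)L)·‖x − x̄‖ for all x, x̄ ∈ [a,b]. -/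
open MeasureTheory Set NNReal

/-- The closed hyperrectangle `[a,b]` in Euclidean space. -/
def BoxE {n : ℕ} (a b : EuclideanSpace ℝ (Fin n)) : Set (EuclideanSpace ℝ (Fin n)) :=
  {y | ∀ i, min (a i) (b i) ≤ y i ∧ y i ≤ max (a i) (b i)}

/-- if `∇F` is `L`-Lipschitz on `[a,b]` and `|∂F/∂xᵢ| ≤ M` on `[a,b]`, then
`x ↦ IGᵢ(x,x',F)` is Lipschitz on `[a,b]` with constant at most `M + |bᵢ - aᵢ|/2 ⬝ L`. -/
theorem IG_lipschitz_of_gradient_lipschitz {n : ℕ} (a b : EuclideanSpace ℝ (Fin n))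
    (i : Fin n) (F : EuclideanSpace ℝ (Fin n) → ℝ) (hF : ContDiff ℝ 1 F)
    (L : ℝ≥0) (hL : LipschitzOnWith L (fderiv ℝ F) (BoxE a b))
    (M : ℝ) (hM : ∀ y ∈ BoxE a b, |fderiv ℝ F y (EuclideanSpace.single i 1)| ≤ M)
    (x' : EuclideanSpace ℝ (Fin n)) (hx' : x' ∈ BoxE a b) :
    ∀ x ∈ BoxE a b, ∀ xb ∈ BoxE a b,
      |IGe F i x x' - IGe F i xb x'| ≤ (M + |b i - a i| / 2 * (L : ℝ)) * ‖x - xb‖ := by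
  intro x hx xb hxb
  have hseg : ∀ z ∈ BoxE a b, ∀ t ∈ Icc (0:ℝ) 1, x' + t • (z - x') ∈ BoxE a b := by
    intro z hz t ht j
    obtain ⟨h1, h2⟩ := hz j
    obtain ⟨h3, h4⟩ := hx' j
    obtain ⟨h5, h6⟩ := ht
    simp only [PiLp.add_apply, PiLp.smul_apply, PiLp.sub_apply, smul_eq_mul]
    constructor
    · nlinarith [mul_le_mul_of_nonneg_left h1 h5,
        mul_le_mul_of_nonneg_left h3 (sub_nonneg.2 h6)]
    · nlinarith [mul_le_mul_of_nonneg_left h2 h5,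
        mul_le_mul_of_nonneg_left h4 (sub_nonneg.2 h6)]
  have hcont : ∀ z : EuclideanSpace ℝ (Fin n), Continuous
      (fun t : ℝ => fderiv ℝ F (x' + t • (z - x')) (EuclideanSpace.single i 1)) := by
    intro z
    have h1 : Continuous (fderiv ℝ F) := hF.continuous_fderiv (by norm_num)
    have h2 : Continuous (fun t : ℝ => x' + t • (z - x')) := by fun_prop
    exact (h1.comp h2).clm_apply continuous_const
  have hG : |∫ t in (0:ℝ)..1, fderiv ℝ F (x' + t • (x - x')) (EuclideanSpace.single i 1)|
      ≤ M := by
    have := intervalIntegral.norm_integral_le_of_norm_le_const (a := (0:ℝ)) (b := 1) (C := M)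
      (f := fun t : ℝ => fderiv ℝ F (x' + t • (x - x')) (EuclideanSpace.single i 1)) (by
        intro t ht
        rw [uIoc_of_le zero_le_one] at ht
        exact hM _ (hseg x hx t ⟨ht.1.le, ht.2⟩))
    simpa using this
  have hD : |(∫ t in (0:ℝ)..1, fderiv ℝ F (x' + t • (x - x')) (EuclideanSpace.single i 1)) -
      ∫ t in (0:ℝ)..1, fderiv ℝ F (x' + t • (xb - x')) (EuclideanSpace.single i 1)|
      ≤ L / 2 * ‖x - xb‖ := by
    rw [← intervalIntegral.integral_sub ((hcont x).intervalIntegrable _ _)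
      ((hcont xb).intervalIntegrable _ _)]
    have h := intervalIntegral.norm_integral_le_of_norm_le (a := (0:ℝ)) (b := 1)
      (μ := volume)
      (f := fun t : ℝ => fderiv ℝ F (x' + t • (x - x')) (EuclideanSpace.single i 1) -
        fderiv ℝ F (x' + t • (xb - x')) (EuclideanSpace.single i 1))
      (g := fun t : ℝ => t * (L * ‖x - xb‖)) zero_le_one (by
        refine Filter.Eventually.of_forall fun t ht => ?_
        have ht' : t ∈ Icc (0:ℝ) 1 := ⟨ht.1.le, ht.2⟩
        rw [← ContinuousLinearMap.sub_apply]
        refine (ContinuousLinearMap.le_opNorm _ _).trans ?_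
        have h1 := hL.norm_sub_le (hseg x hx t ht') (hseg xb hxb t ht')
        have h2 : x' + t • (x - x') - (x' + t • (xb - x')) = t • (x - xb) := by module
        rw [h2, norm_smul, Real.norm_of_nonneg ht'.1] at h1
        simp only [EuclideanSpace.norm_single, norm_one, mul_one]
        linarith)
      ((by fun_prop : Continuous fun t : ℝ => t * (L * ‖x - xb‖)).intervalIntegrable _ _)
    rw [intervalIntegral.integral_mul_const, integral_id] at h
    rw [← Real.norm_eq_abs]
    refine h.trans (le_of_eq ?_)
    ring
  have hc : |xb i - x' i| ≤ |b i - a i| := by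
    obtain ⟨h1, h2⟩ := hxb i
    obtain ⟨h3, h4⟩ := hx' i
    have := max_sub_min_eq_abs (a i) (b i)
    rw [← this, abs_le]
    constructor <;> linarith
  have hi : |x i - xb i| ≤ ‖x - xb‖ := by
    simpa using PiLp.norm_apply_le (x - xb) i
  unfold IGe
  generalize (∫ t in (0:ℝ)..1, fderiv ℝ F (x' + t • (x - x')) (EuclideanSpace.single i 1)) = G
    at *
  generalize (∫ t in (0:ℝ)..1, fderiv ℝ F (x' + t • (xb - x')) (EuclideanSpace.single i 1)) = H
    at *
  have e : (x i - x' i) * G - (xb i - x' i) * H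
      = (x i - xb i) * G + (xb i - x' i) * (G - H) := by ring
  rw [e]
  refine (abs_add_le _ _).trans ?_
  rw [abs_mul, abs_mul]
  have k1 := mul_le_mul hi hG (abs_nonneg _) (norm_nonneg _)
  have k2 := mul_le_mul hc hD (abs_nonneg _) (abs_nonneg _)
  linarith
end

section
/- (Distributional sensitivity(a).) Let F : [a,b] → ℝ be continuously differentiable, let x ∈ [a,b], and let X' be a random vector taking values in [a,b] such that X'ⱼ = xⱼ almost surely for every j ≠ i, F(X') is integrable, and IGᵢ(x,X',F) is integrable. If E[F(X')] ≠ F(x), then EGᵢ(x,X',F) := E[IGᵢ(x,X',F)] ≠ 0. -/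
open MeasureTheory Set

/-- Completeness of integrated gradients along a coordinate direction. -/
theorem IG_eq_of_agree {n : ℕ} (F : (Fin n → ℝ) → ℝ) (hF : ContDiff ℝ 1 F) (i : Fin n)
    (x x' : Fin n → ℝ) (h : ∀ j, j ≠ i → x' j = x j) : IG F i x x' = F x - F x' := by
  have hd : x - x' = (x i - x' i) • (Pi.single i 1 : Fin n → ℝ) := by
    ext j
    by_cases hj : j = i
    · subst hj; simp
    · simp [hj, h j hj]
  have hder : ∀ t : ℝ, HasDerivAt (fun t : ℝ => F (x' + t • (x - x')))
      ((x i - x' i) * pderiv' F i (x' + t • (x - x'))) t := by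
    intro t
    have h1 : HasDerivAt (fun t : ℝ => x' + t • (x - x')) (x - x') t := by
      simpa using ((hasDerivAt_id t).smul_const (x - x')).const_add x'
    have h2 := ((hF.differentiable one_ne_zero) (x' + t • (x - x'))).hasFDerivAt
    have h3 := h2.comp_hasDerivAt t h1
    have h4 : (fderiv ℝ F (x' + t • (x - x'))) (x - x')
        = (x i - x' i) * pderiv' F i (x' + t • (x - x')) := by
      generalize x' + t • (x - x') = y
      rw [hd, map_smul, smul_eq_mul, pderiv']
    rw [← h4]
    exact h3
  have hc : Continuous (fun t : ℝ => (x i - x' i) * pderiv' F i (x' + t • (x - x'))) := by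
    have h5 : Continuous (fderiv ℝ F) := hF.continuous_fderiv one_ne_zero
    unfold pderiv'
    fun_prop
  have := intervalIntegral.integral_eq_sub_of_hasDerivAt (a := 0) (b := 1)
    (fun t _ => hder t) (hc.intervalIntegrable 0 1)
  rw [intervalIntegral.integral_const_mul] at this
  rw [IG, this]
  simp

/-- distributional sensitivity(a): if the random baseline `X'` agrees with
`x` in every coordinate except `i` and `E[F(X')] ≠ F(x)`, then `EGᵢ(x,X',F) ≠ 0`. -/
theorem distributional_sensitivity_a {n : ℕ} (a b : Fin n → ℝ)
    (F : (Fin n → ℝ) → ℝ) (hF : ContDiff ℝ 1 F)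
    (x : Fin n → ℝ) (hx : x ∈ Box a b) (i : Fin n)
    {Ω : Type*} [MeasurableSpace Ω] (μ : Measure Ω) [IsProbabilityMeasure μ]
    (X' : Ω → (Fin n → ℝ))
    (hXbox : ∀ᵐ ω ∂μ, X' ω ∈ Box a b)
    (hXfix : ∀ j, j ≠ i → ∀ᵐ ω ∂μ, X' ω j = x j)
    (hFint : Integrable (fun ω => F (X' ω)) μ)
    (hIGint : Integrable (fun ω => IG F i x (X' ω)) μ)
    (hne : (∫ ω, F (X' ω) ∂μ) ≠ F x) :
    (∫ ω, IG F i x (X' ω) ∂μ) ≠ 0 := by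
  have hall : ∀ᵐ ω ∂μ, ∀ j, j ≠ i → X' ω j = x j := by
    rw [ae_all_iff]
    intro j
    by_cases hj : j = i
    · simp [hj]
    · filter_upwards [hXfix j hj] with ω hω _ using hω
  have heq : (fun ω => IG F i x (X' ω)) =ᵐ[μ] fun ω => F x - F (X' ω) := by
    filter_upwards [hall] with ω hω using IG_eq_of_agree F hF i x (X' ω) hω
  rw [integral_congr_ae heq, integral_sub (integrable_const _) hFint]
  simp only [integral_const, probReal_univ, one_smul]
  exact sub_ne_zero.mpr hne.symm
end

section
/- (Distributional completeness.) Let F : [a,b] → ℝ be continuously differentiable, let x ∈ [a,b], and let X' be a random vector taking values in [a,b] such that F(X') and each IGᵢ(x,X',F), i = 1,…,n, are integrable. Then ∑_{i=1}^n EGᵢ(x,X',F) = F(x) − E[F(X')], where EGᵢ(x,X',F) := E[IGᵢ(x,X',F)]. -/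
open MeasureTheory Set

theorem IG_completeness_aux {n : ℕ} (F : (Fin n → ℝ) → ℝ) (hF : ContDiff ℝ 1 F)
    (x x' : Fin n → ℝ) : ∑ i, IG F i x x' = F x - F x' := by
  have hcf : Continuous (fderiv ℝ F) := hF.continuous_fderiv (by norm_num)
  have hpath : Continuous (fun t : ℝ => x' + t • (x - x')) := by fun_prop
  have hc : ∀ i, Continuous (fun t : ℝ => pderiv' F i (x' + t • (x - x'))) := by
    intro i
    unfold pderiv'
    exact (hcf.comp hpath).clm_apply continuous_const
  have hd : ∀ t : ℝ, HasDerivAt (fun t : ℝ => F (x' + t • (x - x')))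
      (∑ i, (x i - x' i) * pderiv' F i (x' + t • (x - x'))) t := by
    intro t
    have h1 : HasDerivAt (fun t : ℝ => x' + t • (x - x')) (x - x') t := by
      simpa using ((hasDerivAt_id t).smul_const (x - x')).const_add x'
    have h2 := ((hF.differentiable (by norm_num)) (x' + t • (x - x'))).hasFDerivAt
    have h3 := h2.comp_hasDerivAt t h1
    have key : ∀ (L : (Fin n → ℝ) →L[ℝ] ℝ) (v : Fin n → ℝ),
        ∑ i, v i * L (Pi.single i 1) = L v := by
      intro L v
      have hv : v = ∑ i, v i • (Pi.single i (1 : ℝ) : Fin n → ℝ) := by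
        ext j
        simp [Finset.sum_apply, Pi.single_apply]
      conv_rhs => rw [hv]
      simp only [map_sum, map_smul, smul_eq_mul]
    rw [← key] at h3
    exact h3
  have hm : ∀ i, Continuous (fun t : ℝ => (x i - x' i) * pderiv' F i (x' + t • (x - x'))) :=
    fun i => continuous_const.mul (hc i)
  have hftc := intervalIntegral.integral_eq_sub_of_hasDerivAt (a := 0) (b := 1)
    (fun t _ => hd t)
    (Continuous.intervalIntegrable
      (continuous_finsetSum _ fun i _ => hm i) _ _)
  rw [intervalIntegral.integral_finsetSum
    (fun i _ => (hm i).intervalIntegrable _ _)] at hftc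
  simpa [IG] using hftc

/-- distributional completeness:
`∑ᵢ EGᵢ(x,X',F) = F(x) - E[F(X')]`. -/
theorem distributional_completeness {n : ℕ} (a b : Fin n → ℝ)
    (F : (Fin n → ℝ) → ℝ) (hF : ContDiff ℝ 1 F)
    (x : Fin n → ℝ) (hx : x ∈ Box a b)
    {Ω : Type*} [MeasurableSpace Ω] (μ : Measure Ω) [IsProbabilityMeasure μ]
    (X' : Ω → (Fin n → ℝ))
    (hXbox : ∀ᵐ ω ∂μ, X' ω ∈ Box a b)
    (hFint : Integrable (fun ω => F (X' ω)) μ)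
    (hIGint : ∀ i, Integrable (fun ω => IG F i x (X' ω)) μ) :
    ∑ i, (∫ ω, IG F i x (X' ω) ∂μ) = F x - ∫ ω, F (X' ω) ∂μ := by
  rw [← integral_finsetSum _ (fun i _ => hIGint i)]
  simp only [IG_completeness_aux F hF x]
  rw [integral_sub (integrable_const _) hFint]
  simp
end

section
/- (Distributional symmetry preserving.) Let F : ℝⁿ → ℝ be continuously differentiable and fix indices i ≠ j. For y ∈ ℝⁿ let y* denote y with coordinates i and j swapped. Suppose F(y) = F(y*) for all y, let x satisfy xᵢ = xⱼ, and let X' be a random baseline such that X' and X'* are identically distributed (i.e., X'ᵢ and X'ⱼ are exchangeable), with IGᵢ(x,X',F) and IGⱼ(x,X',F) integrable. Then EGᵢ(x,X',F) = EGⱼ(x,X',F). -/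
open MeasureTheory Set

/-- Swapping coordinates exchanges the partial derivatives of a symmetric function. -/
lemma pderiv_swap_aux {n : ℕ} (F : (Fin n → ℝ) → ℝ) (hF : ContDiff ℝ 1 F) (i j : Fin n)
    (hsym : ∀ y : Fin n → ℝ, F (fun k => y (Equiv.swap i j k)) = F y) (y : Fin n → ℝ) :
    pderiv' F j (fun k => y (Equiv.swap i j k)) = pderiv' F i y := by
  let L : (Fin n → ℝ) →L[ℝ] (Fin n → ℝ) :=
    ContinuousLinearMap.pi fun k => ContinuousLinearMap.proj (Equiv.swap i j k)
  have hL : ∀ z, L z = fun k => z (Equiv.swap i j k) := fun z => rfl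
  have hd : Differentiable ℝ F := hF.differentiable (by norm_num)
  have h1 : HasFDerivAt (F ∘ L) ((fderiv ℝ F (L y)).comp L) y :=
    (hd (L y)).hasFDerivAt.comp y L.hasFDerivAt
  have h2 : F ∘ L = F := funext hsym
  rw [h2] at h1
  have h3 : L (Pi.single i 1) = Pi.single j 1 := by
    ext k
    rw [hL]
    simp only [Pi.single_apply]
    congr 1
    rw [Equiv.swap_apply_eq_iff, Equiv.swap_apply_left]
  unfold pderiv'
  rw [h1.fderiv, ContinuousLinearMap.comp_apply, h3, hL]

lemma continuous_IG_aux {n : ℕ} (F : (Fin n → ℝ) → ℝ) (hF : ContDiff ℝ 1 F) (i : Fin n)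
    (x : Fin n → ℝ) : Continuous (IG F i x) := by
  have hc : Continuous (pderiv' F i) :=
    (hF.continuous_fderiv (by norm_num)).clm_apply continuous_const
  unfold IG
  refine Continuous.mul (by fun_prop) ?_
  apply intervalIntegral.continuous_parametric_intervalIntegral_of_continuous'
  exact hc.comp (by fun_prop)

lemma IG_swap_aux {n : ℕ} (F : (Fin n → ℝ) → ℝ) (hF : ContDiff ℝ 1 F) (i j : Fin n)
    (hsym : ∀ y : Fin n → ℝ, F (fun k => y (Equiv.swap i j k)) = F y)
    (x : Fin n → ℝ) (hxij : x i = x j) (y : Fin n → ℝ) :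
    IG F j x (fun k => y (Equiv.swap i j k)) = IG F i x y := by
  have hx : ∀ k, x (Equiv.swap i j k) = x k := by
    intro k
    rw [Equiv.swap_apply_def]
    split_ifs <;> simp_all
  unfold IG
  beta_reduce
  rw [Equiv.swap_apply_right, hxij]
  congr 1
  apply intervalIntegral.integral_congr
  intro t _
  simp only
  rw [← pderiv_swap_aux F hF i j hsym]
  congr 1
  ext k
  simp [hx]

/-- distributional symmetry preserving: if `F` is symmetric in coordinates
`i` and `j`, `xᵢ = xⱼ`, and `X'ᵢ, X'ⱼ` are exchangeable, then `EGᵢ = EGⱼ`. -/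
theorem distributional_symmetry_preserving {n : ℕ}
    (F : (Fin n → ℝ) → ℝ) (hF : ContDiff ℝ 1 F)
    (i j : Fin n) (hij : i ≠ j)
    (hsym : ∀ y : Fin n → ℝ, F (fun k => y (Equiv.swap i j k)) = F y)
    (x : Fin n → ℝ) (hxij : x i = x j)
    {Ω : Type*} [MeasurableSpace Ω] (μ : Measure Ω) [IsProbabilityMeasure μ]
    (X' : Ω → (Fin n → ℝ))
    (hexch : ProbabilityTheory.IdentDistrib X'
      (fun ω => fun k => X' ω (Equiv.swap i j k)) μ μ)
    (hinti : Integrable (fun ω => IG F i x (X' ω)) μ)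
    (hintj : Integrable (fun ω => IG F j x (X' ω)) μ) :
    (∫ ω, IG F i x (X' ω) ∂μ) = ∫ ω, IG F j x (X' ω) ∂μ := by
  have h := (hexch.comp (continuous_IG_aux F hF j x).measurable).integral_eq
  simp only [Function.comp_def, IG_swap_aux F hF i j hsym x hxij] at h
  exact h.symm
end

section
/- (Distributional NDP.) Let F : [a,b] → ℝ be continuously differentiable, let x ∈ [a,b], and let X' be a random vector taking values in [a,b] with each IGᵢ(x,X',F) integrable. If F is non-decreasing from x'₀ to x for every point x'₀ in the support of the distribution of X' (meaning F∘γ is non-decreasing on [0,1] for every monotone path γ from x'₀ to x), then EGᵢ(x,X',F) ≥ 0 for every i, where EGᵢ(x,X',F) := E[IGᵢ(x,X',F)]. -/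
open MeasureTheory Set

/-- The (topological) support of a measure `ν` on `ℝⁿ`: points all of whose open
neighborhoods have positive measure. -/
def MeasSupport {n : ℕ} (ν : Measure (Fin n → ℝ)) : Set (Fin n → ℝ) :=
  {y | ∀ U : Set (Fin n → ℝ), IsOpen U → y ∈ U → 0 < ν U}

lemma exists_reparam (s : ℝ) (h0 : 0 < s) (h1 : s < 1) :
    ∃ g : ℝ → ℝ, ContDiff ℝ 1 g ∧ Monotone g ∧ g 0 = 0 ∧ g 1 = 1 ∧ g (1/2) = s ∧
      0 < deriv g (1/2) := by
  by_cases hs : s = 1/2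
  · exact ⟨id, contDiff_id, monotone_id, rfl, rfl, by simp [hs], by simp⟩
  · set E : ℝ := (1 - s) / s with hE
    have hEpos : 0 < E := div_pos (by linarith) h0
    have hE1 : E ≠ 1 := by
      intro h
      rw [hE, div_eq_one_iff_eq h0.ne'] at h
      exact hs (by linarith)
    set k : ℝ := 2 * Real.log E with hk
    have hek : Real.exp k = E ^ 2 := by
      rw [hk, two_mul, Real.exp_add, Real.exp_log hEpos, sq]
    have hek2 : Real.exp (k * (1/2)) = E := by
      rw [hk]
      rw [show 2 * Real.log E * (1/2) = Real.log E by ring, Real.exp_log hEpos]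
    have hden : E ^ 2 - 1 ≠ 0 := by
      have : E ^ 2 - 1 = (E - 1) * (E + 1) := by ring
      rw [this]
      exact mul_ne_zero (sub_ne_zero.2 hE1) (by linarith)
    have hkpos : 0 < k / (E ^ 2 - 1) := by
      rcases lt_or_gt_of_ne hE1 with h | h
      · apply div_pos_of_neg_of_neg
        · have := Real.log_neg hEpos h
          linarith
        · nlinarith
      · apply div_pos
        · have := Real.log_pos h
          linarith
        · nlinarith
    have hd : ∀ t, HasDerivAt (fun t => (Real.exp (k * t) - 1) / (E ^ 2 - 1))
        (k / (E ^ 2 - 1) * Real.exp (k * t)) t := by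
      intro t
      have h := ((((hasDerivAt_id t).const_mul k).exp).sub_const 1).div_const (E ^ 2 - 1)
      refine HasDerivAt.congr_deriv h ?_
      simp only [id, mul_one]
      ring
    refine ⟨fun t => (Real.exp (k * t) - 1) / (E ^ 2 - 1), by fun_prop, ?_, by simp, ?_, ?_, ?_⟩
    · apply monotone_of_deriv_nonneg
      · exact fun t => (hd t).differentiableAt
      · intro t
        rw [(hd t).deriv]
        positivity
    · simp only [mul_one, hek]
      exact div_self hden
    · simp only [hek2]
      have : E + 1 = 1 / s := by rw [hE]; field_simp; ring
      have h2 : E ^ 2 - 1 = (E - 1) * (1 / s) := by rw [← this]; ring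
      have h3 : E - 1 ≠ 0 := sub_ne_zero.2 hE1
      rw [h2]
      field_simp
    · rw [(hd _).deriv]
      positivity

lemma pderiv_mul_nonneg {n : ℕ} (F : (Fin n → ℝ) → ℝ) (hF : ContDiff ℝ 1 F)
    (x y : Fin n → ℝ) (h : NonDecreasingFromTo F y x) (i : Fin n) (s : ℝ)
    (h0 : 0 < s) (h1 : s < 1) :
    0 ≤ (x i - y i) * pderiv' F i (y + s • (x - y)) := by
  obtain ⟨g, hg, hmono, hg0, hg1, hgs, hgd⟩ := exists_reparam s h0 h1
  let p : ℝ → ℝ := fun t => 1/2 + 4 * (t - 1/2) ^ 3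
  have hp : ContDiff ℝ 1 p := by fun_prop
  have hpm : Monotone p := by
    intro u v huv
    have : (u - 1/2) ^ 3 ≤ (v - 1/2) ^ 3 := by
      apply (Odd.strictMono_pow (by decide : Odd 3)).monotone
      linarith
    simp only [p]
    linarith
  let φ : Fin n → ℝ → ℝ := fun j => if j = i then g else g ∘ p
  have hφ : ∀ j, ContDiff ℝ 1 (φ j) := by
    intro j
    by_cases hj : j = i
    · simpa [φ, hj] using hg
    · simpa [φ, hj] using hg.comp hp
  have hφm : ∀ j, Monotone (φ j) := by
    intro j
    by_cases hj : j = i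
    · simpa [φ, hj] using hmono
    · simpa [φ, hj] using hmono.comp hpm
  have p0 : p 0 = 0 := by norm_num [p]
  have p1 : p 1 = 1 := by norm_num [p]
  have p2 : p (1/2) = 1/2 := by norm_num [p]
  have hφ0 : ∀ j, φ j 0 = 0 := by
    intro j
    by_cases hj : j = i <;> simp [φ, hj, hg0, p0]
  have hφ1 : ∀ j, φ j 1 = 1 := by
    intro j
    by_cases hj : j = i <;> simp [φ, hj, hg1, p1]
  have hφs : ∀ j, φ j (1/2) = s := by
    intro j
    by_cases hj : j = i
    · simp only [φ, hj, if_true, hgs]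
    · simp only [φ, hj, if_false, Function.comp, p2, hgs]
  have hφd : ∀ j, HasDerivAt (φ j) (if j = i then deriv g (1/2) else 0) (1/2) := by
    intro j
    have hgD : HasDerivAt g (deriv g (1/2)) (1/2) :=
      (hg.differentiable (by norm_num) _).hasDerivAt
    by_cases hj : j = i
    · simpa only [φ, hj, if_true] using hgD
    · simp only [φ, hj, if_false]
      have hpD : HasDerivAt p 0 (1/2) := by
        have := ((((hasDerivAt_id (1/2:ℝ)).sub_const (1/2)).pow 3).const_mul 4).const_add (1/2)
        refine HasDerivAt.congr_deriv this ?_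
        norm_num
      have := HasDerivAt.comp (h₂ := g) (1/2:ℝ) (by rw [p2]; exact hgD) hpD
      simpa using this
  let γ : ℝ → Fin n → ℝ := fun t j => y j + φ j t * (x j - y j)
  have hγ : ContDiff ℝ 1 γ := by
    rw [contDiff_pi]
    intro j
    have := hφ j
    fun_prop
  have hdγ : Continuous (deriv γ) := hγ.continuous_deriv (le_refl _)
  have hpath : IsPWC1Path γ y x := by
    refine ⟨hγ.continuous.continuousOn, ?_, ?_, ∅, ?_, hdγ.continuousOn,
      hdγ.intervalIntegrable _ _⟩
    · ext j; simp [γ, hφ0]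
    · ext j; simp [γ, hφ1]
    · intro t _
      exact hγ.differentiable (by norm_num) t
  have hmonop : IsMonotonePath γ := by
    intro j
    rcases le_total 0 (x j - y j) with hj | hj
    · left
      intro u _ v _ huv
      have := mul_le_mul_of_nonneg_right (hφm j huv) hj
      simp only [γ]
      linarith
    · right
      intro u _ v _ huv
      have := mul_le_mul_of_nonpos_right (hφm j huv) hj
      simp only [γ]
      linarith
  have hM := h γ hpath hmonop
  have hγs : γ (1/2) = y + s • (x - y) := by
    ext j
    simp only [γ, hφs]
    simp
  have hγd : HasDerivAt γ (Pi.single i (deriv g (1/2) * (x i - y i))) (1/2) := by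
    rw [hasDerivAt_pi]
    intro j
    have := ((hφd j).mul_const (x j - y j)).const_add (y j)
    convert this using 1
    by_cases hj : j = i
    · subst hj; simp
    · simp [hj]
  have hFd : HasFDerivAt F (fderiv ℝ F (γ (1/2))) (γ (1/2)) :=
    (hF.differentiable (by norm_num) _).hasFDerivAt
  have hcomp := hFd.comp_hasDerivAt (1/2:ℝ) hγd
  have hnn : 0 ≤ derivWithin (fun t => F (γ t)) (Set.Icc 0 1) (1/2) := hM.derivWithin_nonneg
  have hcw : HasDerivWithinAt (fun t => F (γ t)) _ (Set.Icc 0 1) (1/2) := hcomp.hasDerivWithinAt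
  rw [hcw.derivWithin (uniqueDiffOn_Icc zero_lt_one _ (by norm_num))] at hnn
  have hs : (Pi.single i (deriv g (1/2) * (x i - y i)) : Fin n → ℝ)
      = (deriv g (1/2) * (x i - y i)) • Pi.single i (1:ℝ) := by
    rw [← Pi.single_smul]; simp
  rw [hs, map_smul, hγs, smul_eq_mul, mul_assoc] at hnn
  exact nonneg_of_mul_nonneg_right hnn hgd

lemma IG_nonneg {n : ℕ} (F : (Fin n → ℝ) → ℝ) (hF : ContDiff ℝ 1 F)
    (x y : Fin n → ℝ) (h : NonDecreasingFromTo F y x) (i : Fin n) : 0 ≤ IG F i x y := by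
  unfold IG
  rw [← intervalIntegral.integral_const_mul]
  rw [intervalIntegral.integral_of_le zero_le_one, integral_Ioc_eq_integral_Ioo]
  apply setIntegral_nonneg measurableSet_Ioo
  intro t ht
  exact pderiv_mul_nonneg F hF x y h i t ht.1 ht.2

/-- distributional NDP: if `F` is non-decreasing from every point of the
support of the distribution of `X'` to `x`, then `EGᵢ(x,X',F) ≥ 0` for every `i`. -/
theorem distributional_NDP {n : ℕ} (a b : Fin n → ℝ)
    (F : (Fin n → ℝ) → ℝ) (hF : ContDiff ℝ 1 F)
    (x : Fin n → ℝ) (hx : x ∈ Box a b)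
    {Ω : Type*} [MeasurableSpace Ω] (μ : Measure Ω) [IsProbabilityMeasure μ]
    (X' : Ω → (Fin n → ℝ)) (hXm : Measurable X')
    (hXbox : ∀ᵐ ω ∂μ, X' ω ∈ Box a b)
    (hint : ∀ i, Integrable (fun ω => IG F i x (X' ω)) μ)
    (hnd : ∀ x0 ∈ MeasSupport (μ.map X'), NonDecreasingFromTo F x0 x) :
    ∀ i, 0 ≤ ∫ ω, IG F i x (X' ω) ∂μ := by
  intro i
  have hsupp : ∀ᵐ y ∂(μ.map X'), y ∈ MeasSupport (μ.map X') := by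
    filter_upwards [Measure.support_mem_ae (μ := μ.map X')] with y hy
    rw [Measure.mem_support_iff_forall] at hy
    exact fun U hU hyU => hy U (hU.mem_nhds hyU)
  apply integral_nonneg_of_ae
  filter_upwards [ae_of_ae_map hXm.aemeasurable hsupp] with ω hω
  exact IG_nonneg F hF x (X' ω) (hnd _ hω) i
end

section
/- Let A be an attribution method defined for all x, x' ∈ ℝⁿ and all continuously differentiable F : ℝⁿ → ℝ with bounded gradient, and suppose A satisfies linearity, affine scale invariance (ASI), and non-decreasing positivity (NDP). Then for every such x, x', F there exist z, z̄ ∈ ℝⁿ with z, z̄ ≥ 0 componentwise and functions G, H : ℝⁿ → ℝ, each non-decreasing in every component, such that A(x,x',F) = A(z,0,G) − A(z̄,0,H), A(z,0,G) ≥ 0 componentwise, and A(z̄,0,H) ≥ 0 componentwise; i.e., the attribution is the difference of cost-shares of two cost-sharing problems. -/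
open MeasureTheory Set

/-- The function class: continuously differentiable with bounded gradient. -/
def GoodF {n : ℕ} (F : (Fin n → ℝ) → ℝ) : Prop :=
  ContDiff ℝ 1 F ∧ ∃ C : ℝ, ∀ y, ‖fderiv ℝ F y‖ ≤ C

/-- The coordinate affine transformation `T(y) = (y₁, …, c yᵢ + d, …, y_n)`. -/
def Taff {n : ℕ} (i : Fin n) (c d : ℝ) (y : Fin n → ℝ) : Fin n → ℝ :=
  Function.update y i (c * y i + d)

/-- The inverse coordinate affine transformation `T⁻¹(y) = (y₁, …, (yᵢ - d)/c, …, y_n)`. -/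
noncomputable def TaffInv {n : ℕ} (i : Fin n) (c d : ℝ) (y : Fin n → ℝ) : Fin n → ℝ :=
  Function.update y i ((y i - d) / c)

theorem goodF_lip {n : ℕ} {F : (Fin n → ℝ) → ℝ} (h : GoodF F) :
    ∃ C : NNReal, LipschitzWith C F := by
  obtain ⟨h1, C, hC⟩ := h
  refine ⟨C.toNNReal, lipschitzWith_of_nnnorm_fderiv_le (𝕜 := ℝ) (h1.differentiable (by simp)) ?_⟩
  intro y
  rw [← NNReal.coe_le_coe, coe_nnnorm]
  exact (hC y).trans (Real.le_coe_toNNReal C)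

theorem goodF_of_lip {n : ℕ} {F : (Fin n → ℝ) → ℝ} (h : ContDiff ℝ 1 F) (C : NNReal)
    (hC : LipschitzWith C F) : GoodF F :=
  ⟨h, C, fun _ => norm_fderiv_le_of_lipschitz ℝ hC⟩

theorem taffInv_contDiff {n : ℕ} (i : Fin n) (c d : ℝ) :
    ContDiff ℝ 1 (TaffInv i c d) := by
  rw [contDiff_pi]
  intro j
  by_cases h : j = i
  · subst h
    simp only [TaffInv, Function.update_self]
    fun_prop
  · simp only [TaffInv, Function.update_of_ne h]
    fun_prop

theorem taffInv_lip {n : ℕ} (i : Fin n) (c d : ℝ) (hc : |c| = 1) :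
    LipschitzWith 1 (TaffInv i c d) := by
  apply LipschitzWith.of_dist_le_mul
  intro x y
  rw [NNReal.coe_one, one_mul, dist_pi_le_iff dist_nonneg]
  intro j
  refine le_trans ?_ (dist_le_pi_dist x y j)
  by_cases h : j = i
  · subst h
    simp only [TaffInv, Function.update_self, Real.dist_eq]
    rw [← sub_div, abs_div, hc]
    simp
  · simp only [TaffInv, Function.update_of_ne h, le_refl]

theorem goodF_taff {n : ℕ} {F : (Fin n → ℝ) → ℝ} (h : GoodF F) (i : Fin n) (c d : ℝ)
    (hc : |c| = 1) : GoodF (fun y => F (TaffInv i c d y)) := by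
  obtain ⟨C, hC⟩ := goodF_lip h
  exact goodF_of_lip (h.1.comp (taffInv_contDiff i c d)) _ (hC.comp (taffInv_lip i c d hc))

theorem goodF_linear {n : ℕ} (L : (Fin n → ℝ) →L[ℝ] ℝ) : GoodF (fun y => L y) :=
  goodF_of_lip L.contDiff _ L.lipschitz

theorem goodF_add {n : ℕ} {F G : (Fin n → ℝ) → ℝ} (hF : GoodF F) (hG : GoodF G) :
    GoodF (fun y => F y + G y) := by
  obtain ⟨C, hC⟩ := goodF_lip hF
  obtain ⟨D, hD⟩ := goodF_lip hG
  exact goodF_of_lip (hF.1.add hG.1) _ (hC.add hD)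

theorem nonDecreasing_of_monotone {n : ℕ} {F : (Fin n → ℝ) → ℝ} (hF : Monotone F)
    {z : Fin n → ℝ} (hz : ∀ k, 0 ≤ z k) : NonDecreasingFromTo F 0 z := by
  intro γ hγ hm s hs t ht hst
  apply hF
  intro k
  rcases hm k with h | h
  · exact h hs ht hst
  · have h0 : (0:ℝ) ∈ Set.Icc (0:ℝ) 1 := by simp
    have h1 : (1:ℝ) ∈ Set.Icc (0:ℝ) 1 := by simp
    have a := h h0 hs hs.1
    have b := h ht h1 ht.2
    have e0 : γ 0 k = 0 := by rw [hγ.2.1]; rfl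
    have e1 : γ 1 k = z k := by rw [hγ.2.2.1]
    have := hz k
    simp only at a b
    linarith

/-- an attribution method on C¹ functions with bounded gradient satisfying
linearity, ASI, and NDP reduces every attribution problem to a difference of cost-shares
of two cost-sharing problems. -/
theorem attribution_is_difference_of_costshares {n : ℕ}
    (A : (Fin n → ℝ) → (Fin n → ℝ) → ((Fin n → ℝ) → ℝ) → (Fin n → ℝ))
    (hlin : ∀ x x' : Fin n → ℝ, ∀ F G : (Fin n → ℝ) → ℝ, GoodF F → GoodF G → ∀ α β : ℝ,
      A x x' (fun y => α * F y + β * G y) = fun k => α * A x x' F k + β * A x x' G k)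
    (hasi : ∀ (i : Fin n) (c d : ℝ), c ≠ 0 → ∀ x x' : Fin n → ℝ,
      ∀ F : (Fin n → ℝ) → ℝ, GoodF F →
        A x x' F = A (Taff i c d x) (Taff i c d x') (fun y => F (TaffInv i c d y)))
    (hndp : ∀ x x' : Fin n → ℝ, ∀ F : (Fin n → ℝ) → ℝ, GoodF F →
      NonDecreasingFromTo F x' x → ∀ k, 0 ≤ A x x' F k) :
    ∀ x x' : Fin n → ℝ, ∀ F : (Fin n → ℝ) → ℝ, GoodF F →
      ∃ (z zb : Fin n → ℝ) (G H : (Fin n → ℝ) → ℝ),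
        (∀ k, 0 ≤ z k) ∧ (∀ k, 0 ≤ zb k) ∧
        GoodF G ∧ GoodF H ∧ Monotone G ∧ Monotone H ∧
        (A x x' F = fun k => A z 0 G k - A zb 0 H k) ∧
        (∀ k, 0 ≤ A z 0 G k) ∧ (∀ k, 0 ≤ A zb 0 H k) := by
  intro x x' F hF
  have key : ∀ s : Finset (Fin n), ∃ (z z' : Fin n → ℝ) (G : (Fin n → ℝ) → ℝ), GoodF G ∧
      A x x' F = A z z' G ∧ ∀ i ∈ s, z' i = 0 ∧ 0 ≤ z i := by
    intro s
    induction s using Finset.induction_on with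
    | empty => exact ⟨x, x', F, hF, rfl, by simp⟩
    | insert i s hi ih =>
      obtain ⟨z, z', G, hG, hA, hs⟩ := ih
      obtain ⟨c, hc, hc'⟩ : ∃ c : ℝ, |c| = 1 ∧ 0 ≤ c * (z i - z' i) := by
        rcases le_total 0 (z i - z' i) with h | h
        · exact ⟨1, by simp, by simpa using h⟩
        · exact ⟨-1, by simp, by linarith⟩
      have hc0 : c ≠ 0 := by
        rintro rfl
        simp at hc
      refine ⟨_, _, _, goodF_taff hG i c (-(c * z' i)) hc,
        hA.trans (hasi i c (-(c * z' i)) hc0 z z' G hG), ?_⟩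
      intro j hj
      by_cases h : j = i
      · subst h
        simp only [Taff, Function.update_self]
        exact ⟨by ring, by linarith⟩
      · simp only [Taff, Function.update_of_ne h]
        exact hs j ((Finset.mem_insert.1 hj).resolve_left h)
  obtain ⟨z, z', F', hF', hA, hz⟩ := key Finset.univ
  have hz0 : z' = 0 := funext fun i => (hz i (Finset.mem_univ i)).1
  subst hz0
  have hzn : ∀ k, 0 ≤ z k := fun i => (hz i (Finset.mem_univ i)).2
  obtain ⟨C, hC⟩ := goodF_lip hF'
  let L : (Fin n → ℝ) →L[ℝ] ℝ := ∑ i, (C : ℝ) • ContinuousLinearMap.proj (R := ℝ) i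
  have hL : ∀ y, L y = ∑ i, (C : ℝ) * y i := by
    intro y
    simp [L, ContinuousLinearMap.sum_apply]
  have hLm : Monotone (fun y => L y) := by
    intro a b hab
    simp only [hL]
    exact Finset.sum_le_sum fun i _ => mul_le_mul_of_nonneg_left (hab i) C.2
  have hGm : Monotone (fun y => F' y + L y) := by
    intro a b hab
    have h1 := hC.dist_le_mul a b
    have h2 : dist a b ≤ ∑ i, (b i - a i) := by
      rw [dist_pi_le_iff (Finset.sum_nonneg fun i _ => sub_nonneg.2 (hab i))]
      intro i
      rw [dist_comm, Real.dist_eq, abs_of_nonneg (sub_nonneg.2 (hab i))]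
      exact Finset.single_le_sum (f := fun i => b i - a i)
        (fun i _ => sub_nonneg.2 (hab i)) (Finset.mem_univ i)
    have h3 := mul_le_mul_of_nonneg_left h2 C.2
    have h4 : L b - L a = C * ∑ i, (b i - a i) := by
      rw [hL, hL, ← Finset.sum_sub_distrib, Finset.mul_sum]
      exact Finset.sum_congr rfl fun i _ => by ring
    have h5 := le_abs_self (F' a - F' b)
    rw [Real.dist_eq] at h1
    have h6 : (C : ℝ) * dist a b ≤ C * ∑ i, (b i - a i) := h3
    show F' a + L a ≤ F' b + L b
    linarith
  have gG := goodF_add hF' (goodF_linear L)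
  have gL := goodF_linear L
  refine ⟨z, z, _, _, hzn, hzn, gG, gL, hGm, hLm, ?_,
    hndp z 0 _ gG (nonDecreasing_of_monotone hGm hzn),
    hndp z 0 _ gL (nonDecreasing_of_monotone hLm hzn)⟩
  have e := hlin z 0 _ _ gG gL 1 (-1)
  have e2 : (fun y => 1 * (F' y + L y) + (-1) * L y) = F' := by
    funext y
    ring
  rw [e2] at e
  rw [hA, e]
  funext k
  ring
end

section
/- Fix a continuous, piecewise continuously differentiable reference path γ₀ : [0,1] → [0,1]ⁿ with γ₀(0) = 0 and γ₀(1) = (1,…,1). For x, x' ∈ ℝⁿ define the path γ(x,x',t) := x' + (x − x') ⊙ γ₀(t) (componentwise product), and define the attribution A(x,x',F) := A^{γ(x,x',·)}(x,x',F) for continuously differentiable F : ℝⁿ → ℝ. Then A satisfies affine scale invariance: for every index i and reals c ≠ 0, d, with T(y) := (y₁,…,cyᵢ+d,…,y_n), one has A(x,x',F) = A(T(x),T(x'),F∘T⁻¹) for all x, x', F. -/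
open MeasureTheory Set

/-- The path `γ(x,x',t) := x' + (x - x') ⊙ γ₀(t)` obtained from a reference path `γ₀`
by componentwise affine rescaling. -/
def ensPath {n : ℕ} (γ₀ : ℝ → (Fin n → ℝ)) (x x' : Fin n → ℝ) : ℝ → (Fin n → ℝ) :=
  fun t m => x' m + (x m - x' m) * γ₀ t m

lemma aux_TaffInv {n : ℕ} (i : Fin n) (c d : ℝ) (y : Fin n → ℝ) :
    HasFDerivAt (TaffInv i c d)
      (ContinuousLinearMap.pi fun m : Fin n =>
        (if m = i then c⁻¹ else 1) • (ContinuousLinearMap.proj m : (Fin n → ℝ) →L[ℝ] ℝ)) y := by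
  rw [hasFDerivAt_pi]
  intro m
  have hp : HasFDerivAt (fun z : Fin n → ℝ => z m)
      (ContinuousLinearMap.proj m : (Fin n → ℝ) →L[ℝ] ℝ) y :=
    (ContinuousLinearMap.proj m : (Fin n → ℝ) →L[ℝ] ℝ).hasFDerivAt
  by_cases h : m = i
  · subst h
    have h2 := (hp.sub_const d).const_smul c⁻¹
    simp only [if_true]
    refine h2.congr_of_eventuallyEq (Filter.Eventually.of_forall fun z => ?_)
    simp [TaffInv, div_eq_inv_mul]
  · simp only [h, if_false, one_smul]
    refine hp.congr_of_eventuallyEq (Filter.Eventually.of_forall fun z => ?_)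
    simp [TaffInv, h]

lemma aux_pderiv {n : ℕ} (i k : Fin n) (c d : ℝ) (y : Fin n → ℝ) (F : (Fin n → ℝ) → ℝ)
    (hF : ContDiff ℝ 1 F) :
    pderiv' (fun y => F (TaffInv i c d y)) k y
      = (if k = i then c⁻¹ else 1) * pderiv' F k (TaffInv i c d y) := by
  have hd : DifferentiableAt ℝ F (TaffInv i c d y) :=
    (hF.differentiable (by norm_num)).differentiableAt
  have h := (hd.hasFDerivAt.comp y (aux_TaffInv i c d y)).fderiv
  unfold pderiv'
  change fderiv ℝ (F ∘ TaffInv i c d) y _ = _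
  rw [h, ContinuousLinearMap.comp_apply, ← smul_eq_mul, ← map_smul]
  congr 1
  ext m
  by_cases hm : m = k
  · subst hm; split_ifs <;> simp [*]
  · have h0 : (Pi.single k (1:ℝ) : Fin n → ℝ) m = 0 := by simp [hm]
    rw [Pi.smul_apply, h0, ContinuousLinearMap.pi_apply, ContinuousLinearMap.smul_apply,
      ContinuousLinearMap.proj_apply, h0, smul_zero, smul_zero]

lemma aux_deriv {n : ℕ} (γ₀ : ℝ → (Fin n → ℝ)) (x x' : Fin n → ℝ) (t : ℝ)
    (h : DifferentiableAt ℝ γ₀ t) (k : Fin n) :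
    deriv (ensPath γ₀ x x') t k = (x k - x' k) * deriv γ₀ t k := by
  have h1 := hasDerivAt_pi.1 h.hasDerivAt
  have h2 : HasDerivAt (ensPath γ₀ x x') (fun m => (x m - x' m) * deriv γ₀ t m) t := by
    rw [hasDerivAt_pi]
    intro m
    exact ((h1 m).const_mul _).const_add _
  rw [h2.deriv]

/-- the path method obtained by affinely rescaling a fixed reference path
`γ₀ : [0,1] → [0,1]ⁿ` from `0` to `(1,…,1)` satisfies affine scale invariance. -/
theorem rescaled_path_method_ASI {n : ℕ} (γ₀ : ℝ → (Fin n → ℝ))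
    (hγ₀ : IsPWC1Path γ₀ (fun _ => 0) (fun _ => 1))
    (hγ₀box : ∀ t ∈ Set.Icc (0:ℝ) 1, ∀ m, γ₀ t m ∈ Set.Icc (0:ℝ) 1)
    (i : Fin n) (c d : ℝ) (hc : c ≠ 0)
    (x x' : Fin n → ℝ) (F : (Fin n → ℝ) → ℝ) (hF : ContDiff ℝ 1 F) :
    ∀ k, pathAttr (ensPath γ₀ x x') F k
      = pathAttr (ensPath γ₀ (Taff i c d x) (Taff i c d x'))
          (fun y => F (TaffInv i c d y)) k := by
  intro k
  obtain ⟨-, -, -, S, hS, -, -⟩ := hγ₀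
  unfold pathAttr
  apply intervalIntegral.integral_congr_ae
  have hnull : ∀ᵐ t : ℝ, t ∉ (insert 1 (S : Set ℝ)) :=
    ((S.finite_toSet.insert 1).measure_zero volume : _) |> measure_eq_zero_iff_ae_notMem.1
  filter_upwards [hnull] with t ht hmem
  rw [uIoc_of_le zero_le_one] at hmem
  simp only [mem_insert_iff, not_or] at ht
  have hd := hS t ⟨⟨hmem.1, lt_of_le_of_ne hmem.2 ht.1⟩, ht.2⟩
  rw [aux_pderiv _ _ _ _ _ _ hF, aux_deriv _ _ _ _ hd, aux_deriv _ _ _ _ hd]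
  have hp : TaffInv i c d (ensPath γ₀ (Taff i c d x) (Taff i c d x') t) = ensPath γ₀ x x' t := by
    ext m
    by_cases hm : m = i
    · subst hm
      simp only [TaffInv, Taff, ensPath, Function.update_self]
      field_simp
      ring
    · simp [TaffInv, Taff, ensPath, hm]
  rw [hp]
  by_cases hk : k = i
  · subst hk
    simp only [Taff, Function.update_self, if_true]
    field_simp
    ring
  · simp [Taff, hk]
end

section
/- Let γ₀ : [0,1] → [0,1]² be the constant-speed piecewise-linear path traveling (0,0) → (1,0) → (1,1) → (0,1) → (0,0) → (1,1), and let F(y₁,y₂) = y₁y₂². Then the path method attribution along γ₀ from baseline (0,0) to input (1,1) equals A^{γ₀}((1,1),(0,0),F) = (−2/3, 5/3). In particular, it has a negative component, whereas F is non-decreasing in each variable on [0,1]² and hence every monotone path method from (0,0) to (1,1) yields componentwise nonnegative attributions; so A^{γ₀}, which satisfies completeness, linearity, and sensitivity(b), is not equal to any average of monotone path methods at this input. -/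
open MeasureTheory Set

/-- Straight-line segment from `p` to `q`, parameterized by `s ∈ [0,1]`. -/
def seg5 (p q : Fin 2 → ℝ) (s : ℝ) : Fin 2 → ℝ := fun m => p m + s * (q m - p m)

/-- The piecewise-linear path `(0,0) → (1,0) → (1,1) → (0,1) → (0,0) → (1,1)`. -/
noncomputable def zigzag : ℝ → (Fin 2 → ℝ) := fun t =>
  if t ≤ 1/5 then seg5 ![0, 0] ![1, 0] (5 * t)
  else if t ≤ 2/5 then seg5 ![1, 0] ![1, 1] (5 * t - 1)
  else if t ≤ 3/5 then seg5 ![1, 1] ![0, 1] (5 * t - 2)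
  else if t ≤ 4/5 then seg5 ![0, 1] ![0, 0] (5 * t - 3)
  else seg5 ![0, 0] ![1, 1] (5 * t - 4)

theorem pd0 (y : Fin 2 → ℝ) : pderiv' (fun y : Fin 2 → ℝ => y 0 * (y 1) ^ 2) 0 y = y 1 ^ 2 ∧
    pderiv' (fun y : Fin 2 → ℝ => y 0 * (y 1) ^ 2) 1 y = 2 * y 0 * y 1 := by
  have h0 : HasFDerivAt (fun y : Fin 2 → ℝ => y 0)
    (ContinuousLinearMap.proj (R := ℝ) (φ := fun _ : Fin 2 => ℝ) 0) y := hasFDerivAt_apply 0 y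
  have h1 : HasFDerivAt (fun y : Fin 2 → ℝ => y 1)
    (ContinuousLinearMap.proj (R := ℝ) (φ := fun _ : Fin 2 => ℝ) 1) y := hasFDerivAt_apply 1 y
  have h := h0.mul (h1.pow 2)
  unfold pderiv'
  have e : fderiv ℝ (fun y : Fin 2 → ℝ => y 0 * (y 1) ^ 2) y = _ := h.fderiv
  rw [e]
  constructor
  · simp
  · simp; ring

theorem seg_hasDeriv (p q : Fin 2 → ℝ) (c t : ℝ) :
    HasDerivAt (fun t => seg5 p q (5 * t - c)) (fun m => 5 * (q m - p m)) t := by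
  rw [hasDerivAt_pi]
  intro m
  unfold seg5
  have h : HasDerivAt (fun t : ℝ => 5 * t - c) 5 t := by
    simpa using ((hasDerivAt_id t).const_mul 5).sub_const c
  exact (h.mul_const (q m - p m)).const_add (p m)

theorem zig_piece (a b c : ℝ) (hab : a ≤ b) (p q : Fin 2 → ℝ)
    (h : ∀ t ∈ Ioo a b, zigzag t = seg5 p q (5 * t - c)) (i : Fin 2)
    (g : (Fin 2 → ℝ) → ℝ) (hg : Continuous g) :
    IntervalIntegrable (fun t => g (zigzag t) * deriv zigzag t i) volume a b ∧
    ∫ t in a..b, g (zigzag t) * deriv zigzag t i =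
      ∫ t in a..b, g (seg5 p q (5 * t - c)) * (5 * (q i - p i)) := by
  have key : ∀ t ∈ Ioo a b, g (zigzag t) * deriv zigzag t i =
      g (seg5 p q (5 * t - c)) * (5 * (q i - p i)) := by
    intro t ht
    have e : zigzag =ᶠ[nhds t] fun t => seg5 p q (5 * t - c) := by
      filter_upwards [Ioo_mem_nhds ht.1 ht.2] with s hs using h s hs
    rw [e.deriv_eq, (seg_hasDeriv p q c t).deriv, h t ht]
  have hc : Continuous fun t : ℝ => g (seg5 p q (5 * t - c)) * (5 * (q i - p i)) := by
    have : Continuous fun t : ℝ => seg5 p q (5 * t - c) := by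
      unfold seg5; fun_prop
    fun_prop
  constructor
  · have := hc.intervalIntegrable (μ := volume) a b
    rw [intervalIntegrable_iff_integrableOn_Ioo_of_le hab] at this ⊢
    exact this.congr_fun (fun t ht => (key t ht).symm) measurableSet_Ioo
  · rw [intervalIntegral.integral_of_le hab, intervalIntegral.integral_of_le hab,
      integral_Ioc_eq_integral_Ioo, integral_Ioc_eq_integral_Ioo]
    exact setIntegral_congr_fun measurableSet_Ioo key

theorem zig_total (i : Fin 2) (g : (Fin 2 → ℝ) → ℝ) (hg : Continuous g) :
    ∫ t in (0:ℝ)..1, g (zigzag t) * deriv zigzag t i =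
      (∫ t in (0:ℝ)..(1/5), g (seg5 ![0, 0] ![1, 0] (5 * t - 0)) * (5 * ((![1,0] : Fin 2 → ℝ) i - (![0,0] : Fin 2 → ℝ) i))) +
      (∫ t in (1/5:ℝ)..(2/5), g (seg5 ![1, 0] ![1, 1] (5 * t - 1)) * (5 * ((![1,1] : Fin 2 → ℝ) i - (![1,0] : Fin 2 → ℝ) i))) +
      (∫ t in (2/5:ℝ)..(3/5), g (seg5 ![1, 1] ![0, 1] (5 * t - 2)) * (5 * ((![0,1] : Fin 2 → ℝ) i - (![1,1] : Fin 2 → ℝ) i))) +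
      (∫ t in (3/5:ℝ)..(4/5), g (seg5 ![0, 1] ![0, 0] (5 * t - 3)) * (5 * ((![0,0] : Fin 2 → ℝ) i - (![0,1] : Fin 2 → ℝ) i))) +
      (∫ t in (4/5:ℝ)..1, g (seg5 ![0, 0] ![1, 1] (5 * t - 4)) * (5 * ((![1,1] : Fin 2 → ℝ) i - (![0,0] : Fin 2 → ℝ) i))) := by
  obtain ⟨i1, e1⟩ := zig_piece 0 (1/5) 0 (by norm_num) ![0, 0] ![1, 0] (by
    rintro t ⟨h1, h2⟩
    unfold zigzag
    rw [if_pos (by linarith), sub_zero]) i g hg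
  obtain ⟨i2, e2⟩ := zig_piece (1/5) (2/5) 1 (by norm_num) ![1, 0] ![1, 1] (by
    rintro t ⟨h1, h2⟩
    unfold zigzag
    rw [if_neg (by linarith), if_pos (by linarith)]) i g hg
  obtain ⟨i3, e3⟩ := zig_piece (2/5) (3/5) 2 (by norm_num) ![1, 1] ![0, 1] (by
    rintro t ⟨h1, h2⟩
    unfold zigzag
    rw [if_neg (by linarith), if_neg (by linarith), if_pos (by linarith)]) i g hg
  obtain ⟨i4, e4⟩ := zig_piece (3/5) (4/5) 3 (by norm_num) ![0, 1] ![0, 0] (by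
    rintro t ⟨h1, h2⟩
    unfold zigzag
    rw [if_neg (by linarith), if_neg (by linarith), if_neg (by linarith),
      if_pos (by linarith)]) i g hg
  obtain ⟨i5, e5⟩ := zig_piece (4/5) 1 4 (by norm_num) ![0, 0] ![1, 1] (by
    rintro t ⟨h1, h2⟩
    unfold zigzag
    rw [if_neg (by linarith), if_neg (by linarith), if_neg (by linarith),
      if_neg (by linarith)]) i g hg
  rw [← e1, ← e2, ← e3, ← e4, ← e5,
    intervalIntegral.integral_add_adjacent_intervals i1 i2,
    intervalIntegral.integral_add_adjacent_intervals (i1.trans i2) i3,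
    intervalIntegral.integral_add_adjacent_intervals ((i1.trans i2).trans i3) i4,
    intervalIntegral.integral_add_adjacent_intervals (((i1.trans i2).trans i3).trans i4) i5]

theorem int_sq : ∫ t in (4/5:ℝ)..1, (5 * t - 4) ^ 2 = 1 / 15 := by
  have h := intervalIntegral.integral_comp_mul_sub (a := 4/5) (b := 1)
    (fun x : ℝ => x ^ 2) (c := 5) (by norm_num) 4
  rw [h, integral_pow]; norm_num

theorem int_lin : ∫ t in (1/5:ℝ)..(2/5), (5 * t - 1) = 1 / 10 := by
  have h := intervalIntegral.integral_comp_mul_sub (a := 1/5) (b := 2/5)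
    (fun x : ℝ => x) (c := 5) (by norm_num) 1
  rw [h, integral_id]; norm_num

theorem mono_nonneg (γ : ℝ → (Fin 2 → ℝ)) (hγ : IsPWC1Path γ ![0, 0] ![1, 1])
    (hm : IsMonotonePath γ) (i : Fin 2) : ∀ t ∈ Ioo (0:ℝ) 1, 0 ≤ γ t i ∧ 0 ≤ deriv γ t i := by
  obtain ⟨-, h0, h1, -⟩ := hγ
  have z : γ 0 i = 0 := by rw [h0]; fin_cases i <;> rfl
  have o : γ 1 i = 1 := by rw [h1]; fin_cases i <;> rfl
  have mono : MonotoneOn (fun t => γ t i) (Icc 0 1) := by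
    rcases hm i with h | h
    · exact h
    · have := h (left_mem_Icc.2 zero_le_one) (right_mem_Icc.2 zero_le_one) zero_le_one
      simp only [z, o] at this
      linarith
  intro t ht
  constructor
  · have := mono (left_mem_Icc.2 zero_le_one) (Ioo_subset_Icc_self ht) ht.1.le
    simpa only [z] using this
  · by_cases hd : DifferentiableAt ℝ γ t
    · have := (hasDerivAt_pi.1 hd.hasDerivAt i)
      rw [← this.deriv, ← derivWithin_of_mem_nhds (Icc_mem_nhds ht.1 ht.2)]
      exact mono.derivWithin_nonneg
    · rw [deriv_zero_of_not_differentiableAt hd]; simp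

theorem zigzag_path_attr_negative_component :
    (pathAttr zigzag (fun y => y 0 * (y 1) ^ 2) 0 = -(2/3) ∧
     pathAttr zigzag (fun y => y 0 * (y 1) ^ 2) 1 = 5/3) ∧
    ∀ γ : ℝ → (Fin 2 → ℝ), IsPWC1Path γ ![0, 0] ![1, 1] → IsMonotonePath γ →
      ∀ i, 0 ≤ pathAttr γ (fun y => y 0 * (y 1) ^ 2) i := by
  refine ⟨⟨?_, ?_⟩, ?_⟩
  · unfold pathAttr
    simp only [fun y => (pd0 y).1]
    rw [zig_total 0 (fun y => y 1 ^ 2) (by fun_prop)]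
    simp only [seg5]
    simp [intervalIntegral.integral_mul_const, int_sq, -one_div]
    norm_num [int_sq]
  · unfold pathAttr
    simp only [fun y => (pd0 y).2]
    rw [zig_total 1 (fun y => 2 * y 0 * y 1) (by fun_prop)]
    have e : ∀ t : ℝ, 2 * (5 * t - 4) * (5 * t - 4) = 2 * (5 * t - 4) ^ 2 := fun t => by ring
    simp only [seg5]
    simp [intervalIntegral.integral_mul_const, intervalIntegral.integral_const_mul, int_lin,
      int_sq, e, -one_div, -intervalIntegral.integral_sub]
    norm_num [int_sq]
  · intro γ hγ hm i
    unfold pathAttr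
    rw [intervalIntegral.integral_of_le zero_le_one, integral_Ioc_eq_integral_Ioo]
    apply setIntegral_nonneg measurableSet_Ioo
    intro t ht
    have h0 := mono_nonneg γ hγ hm 0 t ht
    have h1 := mono_nonneg γ hγ hm 1 t ht
    refine mul_nonneg ?_ (mono_nonneg γ hγ hm i t ht).2
    fin_cases i
    · exact (pd0 (γ t)).1 ▸ sq_nonneg _
    · exact (pd0 (γ t)).2 ▸ mul_nonneg (mul_nonneg zero_le_two h0.1) h1.1
end
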